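/- Let f be a C² local diffeomorphism of 𝕋² of degree d ≥ 2 with C(f) > 0 and inf_{x∈𝕋²} |det Df_x| > 1. For every δ > 0 there exist ℓ₀ > 0 and η > 0 such that for every C² local diffeomorphism g of 𝕋² with d_{C²}(f,g) < η and every x∈𝕋²: p_x^g({x̂ : there exists a local unstable manifold W^u_g(x̂) which is a 1-Lipschitz graph centered at x with length |W^u_g(x̂)| > ℓ₀}) > 1 − δ, where p_x^g is the uniform backward-orbit measure for g. -/

import Mathlib

open MeasureTheory Filter Topology Set
open scoped ENNReal NNReal

noncomputable section


open MeasureTheory Filter Topology Set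
open scoped ENNReal NNReal

noncomputable section

instance fact_zero_lt_one' : Fact ((0:ℝ) < 1) := ⟨one_pos⟩

/-- The plane `ℝ²` with the Euclidean norm: the universal cover of the 2-torus and the
common model of all its tangent spaces. -/
abbrev V2 : Type := EuclideanSpace ℝ (Fin 2)

/-- The flat 2-torus `𝕋² = ℝ²/ℤ²`. -/
abbrev T2 : Type := AddCircle (1 : ℝ) × AddCircle (1 : ℝ)

/-- The covering projection `ℝ² → 𝕋²`. -/
def proj (p : V2) : T2 := (↑(p 0), ↑(p 1))

/-- The integer vector `(m 0, m 1)` as an element of the plane. -/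
def iv (m : Fin 2 → ℤ) : V2 := (WithLp.equiv 2 (Fin 2 → ℝ)).symm (fun i => (m i : ℝ))

/-- A `C^r` local diffeomorphism of the 2-torus, encoded by a `C^r` lift `F : ℝ² → ℝ²`
equivariant with respect to an integer linear part `A`, together with the induced map
`toFun` on the torus and its derivative cocycle `D` (tangent spaces being canonically `ℝ²`);
invertibility of `D` at every point expresses that the map is a local diffeomorphism. -/
structure TorusMap (r : ℕ) : Type where
  F : V2 → V2
  contDiff : ContDiff ℝ r F
  A : Matrix (Fin 2) (Fin 2) ℤ
  equivar : ∀ (p : V2) (m : Fin 2 → ℤ), F (p + iv m) = F p + iv (A.mulVec m)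
  toFun : T2 → T2
  toFun_proj : ∀ p : V2, toFun (proj p) = proj (F p)
  D : T2 → (V2 →L[ℝ] V2)
  D_proj : ∀ p : V2, D (proj p) = fderiv ℝ F p
  isUnit_D : ∀ x : T2, IsUnit (D x)

namespace TorusMap

variable {r : ℕ}

/-- The degree of `f`: the number of preimages of any point, `|det A|`. -/
def deg (f : TorusMap r) : ℕ := f.A.det.natAbs

/-- The derivative of `f^[n]` at `x` (by the chain rule). -/
def Dn (f : TorusMap r) : ℕ → T2 → (V2 →L[ℝ] V2)
  | 0, _ => ContinuousLinearMap.id ℝ V2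
  | n + 1, x => (Dn f n (f.toFun x)).comp (f.D x)

/-- The inverse `(Df^n_x)⁻¹` of the derivative of `f^[n]` at `x`. -/
def Dninv (f : TorusMap r) (n : ℕ) (x : T2) : V2 →L[ℝ] V2 := Ring.inverse (f.Dn n x)

/-- `I(x,v;fⁿ) = d^{-n} ∑_{y ∈ f^{-n}(x)} log ‖(Dfⁿ_y)⁻¹ · v‖`. -/
def I (f : TorusMap r) (x : T2) (v : V2) (n : ℕ) : ℝ :=
  ((f.deg : ℝ) ^ n)⁻¹ * ∑ᶠ y ∈ (f.toFun^[n]) ⁻¹' {x}, Real.log ‖f.Dninv n y v‖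

/-- `inf_{(x,v) ∈ T¹𝕋²} I(x,v;fⁿ)`. -/
def unifInf (f : TorusMap r) (n : ℕ) : ℝ :=
  ⨅ xv : T2 × Metric.sphere (0 : V2) 1, f.I xv.1 (xv.2 : V2) n

/-- `C(f) = liminf_{n→∞} (1/n) inf_{(x,v) ∈ T¹𝕋²} I(x,v;fⁿ)`. -/
def C (f : TorusMap r) : ℝ := Filter.liminf (fun n : ℕ => f.unifInf n / n) Filter.atTop

/-- `I_f(x) = limsup_{n→∞} (1/n) inf_{v ∈ T¹_x𝕋²} I(x,v;fⁿ)`. -/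
def Isup (f : TorusMap r) (x : T2) : ℝ :=
  Filter.limsup (fun n : ℕ => (⨅ v : Metric.sphere (0 : V2) 1, f.I x (v : V2) n) / n)
    Filter.atTop

/-- The determinant of the derivative of `f` at `x`. -/
def detD (f : TorusMap r) (x : T2) : ℝ := LinearMap.det (f.D x : V2 →ₗ[ℝ] V2)

/-- `μ` is an `f`-invariant measure. -/
def Invariant (f : TorusMap r) (μ : Measure T2) : Prop :=
  ∀ s : Set T2, MeasurableSet s → μ (f.toFun ⁻¹' s) = μ s

/-- `μ` is equidistributed: `μ(f(A)) = d·μ(A)` for every Borel set `A` on which `f` is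
injective (equivalently, `μ` maximizes the folding entropy: `F_μ(f) = log d`). -/
def Equidistributed (f : TorusMap r) (μ : Measure T2) : Prop :=
  ∀ s : Set T2, MeasurableSet s → Set.InjOn f.toFun s →
    μ (f.toFun '' s) = (f.deg : ℝ≥0∞) * μ s

end TorusMap

/-- The minimal norm (conorm) of a linear map of the plane. -/
def minNorm (L : V2 →L[ℝ] V2) : ℝ := ⨅ v : Metric.sphere (0 : V2) 1, ‖L (v : V2)‖

/-- `ω` is a backward orbit of `x` under `f`. -/
def IsBackward {r : ℕ} (f : TorusMap r) (x : T2) (ω : ℕ → T2) : Prop :=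
  ω 0 = x ∧ ∀ k, f.toFun (ω (k + 1)) = ω k

/-- The space of backward orbits of `x` under `f`. -/
abbrev Bw {r : ℕ} (f : TorusMap r) (x : T2) : Type := {ω : ℕ → T2 // IsBackward f x ω}

/-- `p` is the uniformly distributed (Bernoulli) measure on the backward orbits of `x`:
each of the `dⁿ` preimages `z ∈ f^{-n}(x)` carries mass `d^{-n}`. -/
def IsBernoulliBw {r : ℕ} (f : TorusMap r) (x : T2) (p : Measure (Bw f x)) : Prop :=
  IsProbabilityMeasure p ∧
    ∀ (n : ℕ) (z : T2), f.toFun^[n] z = x →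
      p {ω : Bw f x | ω.1 n = z} = ((f.deg : ℝ≥0∞) ^ n)⁻¹

/-- The `C^k` distance between two torus maps: sup distance between the values plus the sup
norms of the differences of the derivatives up to order `k`, computed via the lifts. -/
def distC {r : ℕ} (k : ℕ) (f g : TorusMap r) : ℝ :=
  (⨆ x : T2, dist (f.toFun x) (g.toFun x)) +
    ∑ i ∈ Finset.Icc 1 k, ⨆ p : V2, ‖iteratedFDeriv ℝ i f.F p - iteratedFDeriv ℝ i g.F p‖

/-- The length of the curve `σ` (parametrized on `[-1,1]`). -/
def clen (σ : ℝ → V2) : ℝ := ∫ t in (-1 : ℝ)..1, ‖deriv σ t‖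

open scoped RealInnerProductSpace

/-- `σ` is an `L`-Lipschitz graph centered at `x = σ(s₀)`: in the orthogonal splitting
`T_x𝕋² = ℝσ'(s₀) ⊕ ℝσ'(s₀)^⊥`, the curve coincides with (the exponential of) the graph of
an `L`-Lipschitz function. -/
def IsLipGraph (L : ℝ≥0) (σ : ℝ → V2) (s₀ : ℝ) : Prop :=
  ∃ (u w : V2) (φ : ℝ → ℝ) (J : Set ℝ),
    ‖u‖ = 1 ∧ ‖w‖ = 1 ∧ ⟪u, w⟫ = 0 ∧ (∃ c : ℝ, 0 < c ∧ deriv σ s₀ = c • u) ∧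
    LipschitzOnWith L φ J ∧
    σ '' Set.Icc (-1 : ℝ) 1 = (fun t => σ s₀ + t • u + φ t • w) '' J

/-- The cone of width `ε` around the direction `v`. -/
def cone (v : V2) (ε : ℝ) : Set V2 := {w | ‖w - ⟪w, v⟫ • v‖ ≤ ε * |⟪w, v⟫|}


/-- `σ` (a planar lift of a curve in `𝕋²`) is a local unstable manifold at the backward
orbit `ω`: it is a `C¹` embedded curve such that every point on it admits a backward orbit
converging exponentially to `ω`. -/
def IsUnstMan {r : ℕ} (g : TorusMap r) (ω : ℕ → T2) (σ : ℝ → V2) : Prop :=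
  ContDiff ℝ 1 σ ∧ (∀ t ∈ Set.Icc (-1 : ℝ) 1, deriv σ t ≠ 0) ∧
  Set.InjOn (fun t => proj (σ t)) (Set.Icc (-1 : ℝ) 1) ∧
  ∃ Cc : ℝ, 1 ≤ Cc ∧ ∃ lam : ℝ, 0 < lam ∧
    ∀ s ∈ Set.Icc (-1 : ℝ) 1, ∃ ωy : ℕ → T2, IsBackward g (proj (σ s)) ωy ∧
      ∀ n : ℕ, dist (ω n) (ωy n) ≤ Cc * Real.exp (-(n : ℝ) * lam)

section

lemma iv_apply (m : Fin 2 → ℤ) (i : Fin 2) : iv m i = (m i : ℝ) := rfl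

lemma v2_norm_sq (p : V2) : ‖p‖ ^ 2 = p 0 ^ 2 + p 1 ^ 2 := by
  rw [EuclideanSpace.norm_sq_eq]; simp [Fin.sum_univ_two]

lemma v2_abs_le (p : V2) (i : Fin 2) : |p i| ≤ ‖p‖ := by
  have := PiLp.norm_apply_le p i
  simpa using this

lemma v2_norm_le (p : V2) : ‖p‖ ≤ |p 0| + |p 1| := by
  have h := v2_norm_sq p
  have : ‖p‖ ^ 2 ≤ (|p 0| + |p 1|) ^ 2 := by
    rw [h]; nlinarith [sq_abs (p 0), sq_abs (p 1), mul_nonneg (abs_nonneg (p 0)) (abs_nonneg (p 1))]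
  exact abs_le_of_sq_le_sq this (by positivity) |> (le_abs_self _).trans

lemma coe_int_zero (k : ℤ) : (((k : ℝ)) : AddCircle (1:ℝ)) = 0 := by
  rw [AddCircle.coe_eq_zero_iff]; exact ⟨k, by simp⟩

lemma proj_add_iv (p : V2) (m : Fin 2 → ℤ) : proj (p + iv m) = proj p := by
  simp only [proj, PiLp.add_apply, iv_apply, AddCircle.coe_add, coe_int_zero, add_zero]

lemma proj_eq_imp {p q : V2} (h : proj p = proj q) : ∃ m, q = p + iv m := by
  simp only [proj, Prod.mk.injEq] at h
  obtain ⟨h0, h1⟩ := h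
  have h0' : ((q 0 - p 0 : ℝ) : AddCircle (1:ℝ)) = 0 := by rw [AddCircle.coe_sub, h0, sub_self]
  have h1' : ((q 1 - p 1 : ℝ) : AddCircle (1:ℝ)) = 0 := by rw [AddCircle.coe_sub, h1, sub_self]
  rw [AddCircle.coe_eq_zero_iff] at h0' h1'
  obtain ⟨a, ha⟩ := h0'
  obtain ⟨b, hb⟩ := h1'
  refine ⟨![a, b], ?_⟩
  ext i
  fin_cases i
  · simp [iv_apply] at ha ⊢; linarith
  · simp [iv_apply] at hb ⊢; linarith

lemma proj_surj (x : T2) : ∃ p, proj p = x := by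
  obtain ⟨a, b⟩ := x
  obtain ⟨a, rfl⟩ := QuotientAddGroup.mk_surjective a
  obtain ⟨b, rfl⟩ := QuotientAddGroup.mk_surjective b
  exact ⟨!₂[a, b], rfl⟩

lemma circ_dist_le (a b : ℝ) : dist (a : AddCircle (1:ℝ)) (b : AddCircle (1:ℝ)) ≤ |a - b| := by
  rw [dist_eq_norm, ← AddCircle.coe_sub]
  exact QuotientAddGroup.norm_mk_le_norm 

lemma dist_proj_le (p q : V2) : dist (proj p) (proj q) ≤ ‖p - q‖ := by
  rw [Prod.dist_eq]
  apply max_le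
  · exact (circ_dist_le _ _).trans (by simpa using v2_abs_le (p - q) 0)
  · exact (circ_dist_le _ _).trans (by simpa using v2_abs_le (p - q) 1)

lemma exists_lift_close (p : V2) (y : T2) : ∃ q, proj q = y ∧ ‖q - p‖ ≤ 2 * dist y (proj p) := by
  obtain ⟨q, rfl⟩ := proj_surj y
  refine ⟨q + iv (fun i => - round (q i - p i)), proj_add_iv _ _, ?_⟩
  refine (v2_norm_le _).trans ?_
  have key : ∀ a b : ℝ, |a + -((round (a - b) : ℤ) : ℝ) - b| = dist (a : AddCircle (1:ℝ)) b := by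
    intro a b
    rw [dist_eq_norm, ← AddCircle.coe_sub, AddCircle.norm_eq]
    congr 1; simp; ring
  have h0 := key (q 0) (p 0)
  have h1 := key (q 1) (p 1)
  have d0 : dist (q 0 : AddCircle (1:ℝ)) (p 0 : AddCircle (1:ℝ)) ≤ dist (proj q) (proj p) := by
    rw [Prod.dist_eq]; exact le_max_left _ _
  have d1 : dist (q 1 : AddCircle (1:ℝ)) (p 1 : AddCircle (1:ℝ)) ≤ dist (proj q) (proj p) := by
    rw [Prod.dist_eq]; exact le_max_right _ _
  simp only [PiLp.sub_apply, PiLp.add_apply, iv_apply, Int.cast_neg]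
  linarith

lemma iv_zero_of_small {m : Fin 2 → ℤ} (h : ‖iv m‖ < 1) : m = 0 := by
  ext i
  have h1 := (v2_abs_le (iv m) i).trans_lt h
  rw [iv_apply] at h1
  have : |m i| < 1 := by
    apply Int.cast_lt (R := ℝ) |>.mp
    rw [Int.cast_abs, Int.cast_one]; exact h1
  simpa using Int.abs_lt_one_iff.mp this

lemma iv_zero : iv 0 = 0 := by ext i; simp [iv_apply]

lemma iv_sub (m n : Fin 2 → ℤ) : iv (m - n) = iv m - iv n := by
  ext i; simp [iv_apply]

/-- a lift in the unit square -/
lemma exists_rep (p : V2) : ∃ m, p + iv m ∈ Metric.closedBall (0 : V2) 2 := by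
  refine ⟨fun i => - ⌊p i⌋, ?_⟩
  rw [mem_closedBall_zero_iff]
  refine (v2_norm_le _).trans ?_
  have key : ∀ a : ℝ, |a + -((⌊a⌋ : ℤ) : ℝ)| ≤ 1 := by
    intro a
    rw [abs_le]; constructor
    · linarith [Int.floor_le a]
    · linarith [Int.lt_floor_add_one a]
  simp only [PiLp.add_apply, iv_apply, Int.cast_neg]
  linarith [key (p 0), key (p 1)]

namespace TorusMap
variable {r : ℕ}

lemma fderiv_periodic (f : TorusMap r) (p : V2) (m : Fin 2 → ℤ) :
    fderiv ℝ f.F (p + iv m) = fderiv ℝ f.F p := by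
  rw [← f.D_proj, ← f.D_proj, proj_add_iv]

lemma iter_periodic (f : TorusMap r) (k : ℕ) (p : V2) (m : Fin 2 → ℤ) :
    iteratedFDeriv ℝ (k+1) f.F (p + iv m) = iteratedFDeriv ℝ (k+1) f.F p := by
  have h : (fun q => fderiv ℝ f.F (q + iv m)) = fderiv ℝ f.F := by
    ext1 q; exact f.fderiv_periodic q m
  have h2 : iteratedFDeriv ℝ k (fderiv ℝ f.F) (p + iv m) = iteratedFDeriv ℝ k (fderiv ℝ f.F) p := by
    rw [← iteratedFDeriv_comp_add_right, h]
  rw [iteratedFDeriv_succ_eq_comp_right, iteratedFDeriv_succ_eq_comp_right]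
  simp only [Function.comp_apply, h2]

end TorusMap
lemma periodic_bdd {G : Type*} [NormedAddCommGroup G] (φ : V2 → G) (hc : Continuous φ)
    (hp : ∀ p m, φ (p + iv m) = φ p) : ∃ C, ∀ p, ‖φ p‖ ≤ C := by
  obtain ⟨C, hC⟩ := (isCompact_closedBall (0 : V2) 2).exists_bound_of_continuousOn
    (f := φ) hc.continuousOn
  refine ⟨C, fun p => ?_⟩
  obtain ⟨m, hm⟩ := exists_rep p
  rw [← hp p m]; exact hC _ hm

namespace TorusMap

lemma iter_bdd (f : TorusMap 2) (k : ℕ) (hk : k + 1 ≤ 2) :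
    ∃ C, ∀ p, ‖iteratedFDeriv ℝ (k+1) f.F p‖ ≤ C :=
  periodic_bdd _ (f.contDiff.continuous_iteratedFDeriv (by exact_mod_cast hk)) (f.iter_periodic k)

lemma iter_diff_le (f g : TorusMap 2) (η : ℝ) (h : distC 2 f g < η) (k : ℕ) (hk : k + 1 ≤ 2) (p : V2) :
    ‖iteratedFDeriv ℝ (k+1) f.F p - iteratedFDeriv ℝ (k+1) g.F p‖ ≤ η := by
  have hb : BddAbove (range fun p : V2 =>
      ‖iteratedFDeriv ℝ (k+1) f.F p - iteratedFDeriv ℝ (k+1) g.F p‖) := by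
    obtain ⟨C, hC⟩ := f.iter_bdd k hk
    obtain ⟨C', hC'⟩ := g.iter_bdd k hk
    refine ⟨C + C', ?_⟩
    rintro _ ⟨q, rfl⟩
    exact (norm_sub_le _ _).trans (add_le_add (hC q) (hC' q))
  refine (le_ciSup hb p).trans ?_
  refine le_trans ?_ h.le
  unfold distC
  have h1 : (⨆ p : V2, ‖iteratedFDeriv ℝ (k+1) f.F p - iteratedFDeriv ℝ (k+1) g.F p‖) ≤
      ∑ i ∈ Finset.Icc 1 2, ⨆ p : V2, ‖iteratedFDeriv ℝ i f.F p - iteratedFDeriv ℝ i g.F p‖ := by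
    refine Finset.single_le_sum (f := fun i => ⨆ p : V2, ‖iteratedFDeriv ℝ i f.F p - iteratedFDeriv ℝ i g.F p‖)
      (fun i _ => Real.iSup_nonneg fun _ => norm_nonneg _) ?_
    simp [hk]
  have h0 : 0 ≤ ⨆ x : T2, dist (f.toFun x) (g.toFun x) := Real.iSup_nonneg fun _ => dist_nonneg
  linarith

lemma toFun_dist_le (f g : TorusMap 2) (η : ℝ) (h : distC 2 f g < η) (x : T2) :
    dist (f.toFun x) (g.toFun x) ≤ η := by
  have hb : BddAbove (range fun x : T2 => dist (f.toFun x) (g.toFun x)) := by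
    refine ⟨Metric.diam (univ : Set T2), ?_⟩
    rintro _ ⟨q, rfl⟩
    exact Metric.dist_le_diam_of_mem isCompact_univ.isBounded (mem_univ _) (mem_univ _)
  refine (le_ciSup hb x).trans ?_
  refine le_trans ?_ h.le
  unfold distC
  have : 0 ≤ ∑ i ∈ Finset.Icc 1 2, ⨆ p : V2, ‖iteratedFDeriv ℝ i f.F p - iteratedFDeriv ℝ i g.F p‖ :=
    Finset.sum_nonneg fun i _ => Real.iSup_nonneg fun _ => norm_nonneg _
  linarith

lemma fderiv_diff_le (f g : TorusMap 2) (η : ℝ) (h : distC 2 f g < η) (p : V2) :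
    ‖fderiv ℝ f.F p - fderiv ℝ g.F p‖ ≤ η := by
  have hp := f.iter_diff_le g η h 0 (by norm_num) p
  have hf : Differentiable ℝ f.F := f.contDiff.differentiable (by norm_num)
  have hg : Differentiable ℝ g.F := g.contDiff.differentiable (by norm_num)
  rw [iteratedFDeriv_succ_eq_comp_right, iteratedFDeriv_succ_eq_comp_right] at hp
  simp only [Function.comp_apply, ← map_sub, LinearIsometryEquiv.norm_map] at hp
  have : iteratedFDeriv ℝ 0 (fderiv ℝ f.F) p - iteratedFDeriv ℝ 0 (fderiv ℝ g.F) p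
      = iteratedFDeriv ℝ 0 (fun q => fderiv ℝ f.F q - fderiv ℝ g.F q) p := by
    ext; simp
  rw [this, norm_iteratedFDeriv_zero] at hp
  exact hp

lemma fderiv_lip (f : TorusMap 2) (C : ℝ) (hC : ∀ p, ‖iteratedFDeriv ℝ 2 f.F p‖ ≤ C) (p q : V2) :
    ‖fderiv ℝ f.F p - fderiv ℝ f.F q‖ ≤ C * ‖p - q‖ := by
  have hd : Differentiable ℝ (fderiv ℝ f.F) :=
    (f.contDiff.fderiv_right (m := 1) (by norm_num)).differentiable (by norm_num)
  refine Convex.norm_image_sub_le_of_norm_fderiv_le (𝕜 := ℝ) (s := univ) (fun x _ => hd x) (fun x _ => ?_)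
    convex_univ (mem_univ _) (mem_univ _)
  refine le_trans (le_of_eq ?_) (hC x)
  rw [iteratedFDeriv_succ_eq_comp_right]
  simp only [Function.comp_apply, LinearIsometryEquiv.norm_map]
  rw [norm_iteratedFDeriv_one]

end TorusMap
end

section

structure Nice (M : ℝ) (g : TorusMap 2) : Prop where
  one_le : 1 ≤ M
  bd : ∀ x, ‖g.D x‖ ≤ M
  inv : ∀ x v, ‖v‖ ≤ M * ‖g.D x v‖
  lip : ∀ p q, ‖fderiv ℝ g.F p - fderiv ℝ g.F q‖ ≤ M * ‖p - q‖

/-- standard basis vectors -/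
def ev2 (i : Fin 2) : V2 := EuclideanSpace.single i 1

lemma ev2_norm (i : Fin 2) : ‖ev2 i‖ = 1 := by simp [ev2]

lemma v2_decomp (p : V2) : p = p 0 • ev2 0 + p 1 • ev2 1 := by
  ext i; fin_cases i <;> simp [ev2]

lemma det_formula (L : V2 →L[ℝ] V2) : LinearMap.det (L : V2 →ₗ[ℝ] V2) =
    L (ev2 0) 0 * L (ev2 1) 1 - L (ev2 1) 0 * L (ev2 0) 1 := by
  rw [← LinearMap.det_toMatrix (EuclideanSpace.basisFun (Fin 2) ℝ).toBasis, Matrix.det_fin_two]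
  simp [LinearMap.toMatrix_apply, ev2]

lemma entry_le (L : V2 →L[ℝ] V2) (i j : Fin 2) : |L (ev2 i) j| ≤ ‖L‖ := by
  refine (v2_abs_le _ _).trans ((L.le_opNorm _).trans ?_)
  rw [ev2_norm, mul_one]

lemma det_close (A B : V2 →L[ℝ] V2) (M η : ℝ) (hA : ‖A‖ ≤ M) (hB : ‖B‖ ≤ M) (h : ‖A - B‖ ≤ η) :
    |LinearMap.det (A : V2 →ₗ[ℝ] V2) - LinearMap.det (B : V2 →ₗ[ℝ] V2)| ≤ 4 * M * η := by
  rw [det_formula, det_formula]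
  have hM : 0 ≤ M := (norm_nonneg _).trans hA
  have hη : 0 ≤ η := (norm_nonneg _).trans h
  have e : ∀ i j, |A (ev2 i) j - B (ev2 i) j| ≤ η := fun i j => by
    have := (entry_le (A - B) i j).trans h
    simpa using this
  have a : ∀ i j, |A (ev2 i) j| ≤ M := fun i j => (entry_le A i j).trans hA
  have b : ∀ i j, |B (ev2 i) j| ≤ M := fun i j => (entry_le B i j).trans hB
  have key : ∀ a b c d : ℝ, |a| ≤ M → |d| ≤ M → |a - c| ≤ η → |b - d| ≤ η →
      |a * b - c * d| ≤ 2 * M * η := by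
    intro x y z w hx hw hxz hyw
    have : x * y - z * w = x * (y - w) + w * (x - z) := by ring
    rw [this]
    refine (abs_add_le _ _).trans ?_
    rw [abs_mul, abs_mul]
    have h1 := mul_le_mul hx hyw (abs_nonneg _) hM
    have h2 := mul_le_mul hw hxz (abs_nonneg _) hM
    linarith
  have k1 := key _ _ _ _ (a 0 0) (b 1 1) (e 0 0) (e 1 1)
  have k2 := key _ _ _ _ (a 1 0) (b 0 1) (e 1 0) (e 0 1)
  rw [abs_le] at *
  constructor <;> linarith [k1.1, k1.2, k2.1, k2.2]

namespace TorusMap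

lemma fderiv_eq_D (f : TorusMap 2) (p : V2) : fderiv ℝ f.F p = f.D (proj p) := (f.D_proj p).symm

lemma exists_nice (f : TorusMap 2) : ∃ M, Nice M f ∧ ∀ p, ‖iteratedFDeriv ℝ 2 f.F p‖ ≤ M := by
  obtain ⟨C1, hC1⟩ := f.iter_bdd 1 (by norm_num)
  have hcf : Continuous (fderiv ℝ f.F) :=
    (f.contDiff.fderiv_right (m := 1) (by norm_num)).continuous
  obtain ⟨C2, hC2⟩ := periodic_bdd (fderiv ℝ f.F) hcf f.fderiv_periodic
  have hu : ∀ p, IsUnit (fderiv ℝ f.F p) := fun p => by rw [f.fderiv_eq_D]; exact f.isUnit_D _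
  have hci : Continuous (fun p => Ring.inverse (fderiv ℝ f.F p)) := by
    rw [continuous_iff_continuousAt]
    intro p
    obtain ⟨u, hu'⟩ := hu p
    have := NormedRing.inverse_continuousAt u
    rw [hu'] at this
    exact ContinuousAt.comp (g := Ring.inverse) this hcf.continuousAt
  obtain ⟨C3, hC3⟩ := periodic_bdd _ hci (fun p m => by rw [f.fderiv_periodic])
  have hle : ∀ p, ‖iteratedFDeriv ℝ 2 f.F p‖ ≤ max 1 (max C1 (max C2 C3)) := fun p =>
      (hC1 p).trans ((le_max_left _ _).trans (le_max_right _ _))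
  refine ⟨max 1 (max C1 (max C2 C3)), ⟨le_max_left _ _, ?_, ?_, ?_⟩, hle⟩
  · intro x
    obtain ⟨p, rfl⟩ := proj_surj x
    rw [← f.fderiv_eq_D]
    exact (hC2 p).trans ((le_max_left _ _).trans ((le_max_right _ _).trans (le_max_right _ _)))
  · intro x v
    obtain ⟨p, rfl⟩ := proj_surj x
    rw [← f.fderiv_eq_D]
    have h1 : v = Ring.inverse (fderiv ℝ f.F p) (fderiv ℝ f.F p v) := by
      have := Ring.inverse_mul_cancel _ (hu p)
      have := congrArg (fun L : V2 →L[ℝ] V2 => L v) this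
      simpa using this.symm
    conv_lhs => rw [h1]
    refine (ContinuousLinearMap.le_opNorm _ _).trans ?_
    refine mul_le_mul_of_nonneg_right ?_ (norm_nonneg _)
    exact (hC3 p).trans ((le_max_right _ _).trans ((le_max_right _ _).trans (le_max_right _ _)))
  · exact f.fderiv_lip _ hle

lemma A_eq (f g : TorusMap 2) (η : ℝ) (hη : η < 1) (h : distC 2 f g < η) : f.A = g.A := by
  have hf : Differentiable ℝ f.F := f.contDiff.differentiable (by norm_num)
  have hg : Differentiable ℝ g.F := g.contDiff.differentiable (by norm_num)
  have key : ∀ i : Fin 2, f.A.mulVec (Pi.single i 1) = g.A.mulVec (Pi.single i 1) := by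
    intro i
    set m : Fin 2 → ℤ := Pi.single i 1
    have hm : ‖iv m‖ = 1 := by
      have : iv m = ev2 i := by
        ext j; simp [iv_apply, ev2, m, Pi.single_apply]
      rw [this, ev2_norm]
    have hb := Convex.norm_image_sub_le_of_norm_fderiv_le (𝕜 := ℝ) (s := univ)
      (f := fun p => f.F p - g.F p) (C := η)
      (fun x _ => (hf x).sub (hg x))
      (fun x _ => by rw [fderiv_fun_sub (hf x) (hg x)]; exact f.fderiv_diff_le g η h x) convex_univ
      (mem_univ (0 : V2)) (mem_univ (0 + iv m))
    simp only [f.equivar, g.equivar] at hb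
    have e : f.F 0 + iv (f.A.mulVec m) - (g.F 0 + iv (g.A.mulVec m)) - (f.F 0 - g.F 0)
        = iv (f.A.mulVec m - g.A.mulVec m) := by
      rw [iv_sub]; abel
    rw [e, zero_add, sub_zero, hm, mul_one] at hb
    exact sub_eq_zero.mp (iv_zero_of_small (hb.trans_lt hη))
  ext i j
  have := congrFun (key j) i
  simpa using this

lemma setup (f : TorusMap 2) (hdet : 1 < ⨅ x : T2, |f.detD x|) :
    ∃ M, Nice M f ∧ ∃ η₀, 0 < η₀ ∧ ∀ g : TorusMap 2, distC 2 f g < η₀ →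
      Nice M g ∧ (∀ x, 1 ≤ |g.detD x|) ∧ g.deg = f.deg := by
  obtain ⟨M, hM, hM2⟩ := f.exists_nice
  have hM1 := hM.one_le
  set d0 := ⨅ x : T2, |f.detD x| with hd0
  have hfd : ∀ x, d0 ≤ |f.detD x| := fun x =>
    ciInf_le (f := fun x => |f.detD x|) ⟨0, by rintro _ ⟨y, rfl⟩; exact abs_nonneg _⟩ x
  have hN : Nice (2 * M) f := by
    refine ⟨by linarith, fun x => (hM.bd x).trans (by linarith), fun x v => (hM.inv x v).trans ?_,
      fun p q => (hM.lip p q).trans ?_⟩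
    · exact mul_le_mul_of_nonneg_right (by linarith) (norm_nonneg _)
    · exact mul_le_mul_of_nonneg_right (by linarith) (norm_nonneg _)
  refine ⟨2 * M, hN, min (1 / (2 * M)) ((d0 - 1) / (8 * M)), ?_, ?_⟩
  · apply lt_min
    · positivity
    · apply div_pos <;> linarith
  intro g hg
  set η := min (1 / (2 * M)) ((d0 - 1) / (8 * M))
  have hη1 : η ≤ 1 / (2 * M) := min_le_left _ _
  have hη2 : η ≤ (d0 - 1) / (8 * M) := min_le_right _ _
  have hMη : M * η ≤ 1 / 2 := by
    rw [le_div_iff₀ (by positivity)] at hη1; linarith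
  have hηM : η ≤ 1 / 2 := hη1.trans (by
    rw [div_le_div_iff₀ (by positivity) (by norm_num)]; linarith)
  have hDd : ∀ x, ‖f.D x - g.D x‖ ≤ η := fun x => by
    obtain ⟨p, rfl⟩ := proj_surj x
    rw [← f.fderiv_eq_D, ← g.fderiv_eq_D]; exact f.fderiv_diff_le g η hg p
  have hgN : Nice (2 * M) g := by
    refine ⟨by linarith, fun x => ?_, fun x v => ?_, ?_⟩
    · have : ‖g.D x‖ ≤ ‖f.D x‖ + ‖f.D x - g.D x‖ := by
        have := norm_sub_le (f.D x) (f.D x - g.D x); simpa using this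
      linarith [hDd x, hM.bd x]
    · have h1 := hM.inv x v
      have h2 : ‖f.D x v‖ ≤ ‖g.D x v‖ + η * ‖v‖ := by
        have h3 : f.D x v = g.D x v + (f.D x - g.D x) v := by simp
        rw [h3]
        refine (norm_add_le _ _).trans ?_
        have := (f.D x - g.D x).le_of_opNorm_le (hDd x) v
        linarith
      have h4 : M * ‖f.D x v‖ ≤ M * (‖g.D x v‖ + η * ‖v‖) := mul_le_mul_of_nonneg_left h2 (by linarith)
      have h5 : M * η * ‖v‖ ≤ 1 / 2 * ‖v‖ := mul_le_mul_of_nonneg_right hMη (norm_nonneg _)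
      nlinarith
    · refine g.fderiv_lip _ fun p => ?_
      have h1 := f.iter_diff_le g η hg 1 (by norm_num) p
      have h2 : ‖iteratedFDeriv ℝ 2 g.F p‖ ≤ ‖iteratedFDeriv ℝ 2 f.F p‖ +
        ‖iteratedFDeriv ℝ 2 f.F p - iteratedFDeriv ℝ 2 g.F p‖ := by
        have := norm_sub_le (iteratedFDeriv ℝ 2 f.F p) (iteratedFDeriv ℝ 2 f.F p - iteratedFDeriv ℝ 2 g.F p)
        simpa using this
      have h3 := hM2 p
      linarith
  refine ⟨hgN, fun x => ?_, ?_⟩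
  · have h1 := det_close (f.D x) (g.D x) (2 * M) η (hN.bd x) (hgN.bd x) (hDd x)
    have h2 : 4 * (2 * M) * η ≤ d0 - 1 := by
      rw [le_div_iff₀ (by positivity)] at hη2; linarith
    have h3 := hfd x
    have h4 : |f.detD x| - |g.detD x| ≤ |f.detD x - g.detD x| := abs_sub_abs_le_abs_sub _ _
    unfold detD at *
    linarith
  · unfold deg
    rw [f.A_eq g η (by linarith) hg]

end TorusMap
end

section

/-- inverse of the derivative at `x` -/
def binv (g : TorusMap 2) (x : T2) : V2 →L[ℝ] V2 := Ring.inverse (g.D x)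

lemma binv_D (g : TorusMap 2) (x : T2) (v : V2) : binv g x (g.D x v) = v := by
  have := Ring.inverse_mul_cancel _ (g.isUnit_D x)
  have := congrArg (fun L : V2 →L[ℝ] V2 => L v) this
  simpa [binv] using this

lemma D_binv (g : TorusMap 2) (x : T2) (v : V2) : g.D x (binv g x v) = v := by
  have := Ring.mul_inverse_cancel _ (g.isUnit_D x)
  have := congrArg (fun L : V2 →L[ℝ] V2 => L v) this
  simpa [binv] using this

lemma Nice.binv_le {M : ℝ} {g : TorusMap 2} (h : Nice M g) (x : T2) (v : V2) :
    ‖binv g x v‖ ≤ M * ‖v‖ := by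
  have := h.inv x (binv g x v)
  rwa [D_binv] at this

lemma Nice.le_binv {M : ℝ} {g : TorusMap 2} (h : Nice M g) (x : T2) (v : V2) :
    ‖v‖ ≤ M * ‖binv g x v‖ := by
  have := (g.D x).le_of_opNorm_le (h.bd x) (binv g x v)
  rwa [D_binv] at this

lemma ring_inverse_mul {R : Type*} [MonoidWithZero R] (a b : R) (ha : IsUnit a) (hb : IsUnit b) :
    Ring.inverse (a * b) = Ring.inverse b * Ring.inverse a := by
  obtain ⟨u, rfl⟩ := ha
  obtain ⟨w, rfl⟩ := hb
  rw [← Units.val_mul, Ring.inverse_unit, Ring.inverse_unit, Ring.inverse_unit, mul_inv_rev,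
    Units.val_mul]

lemma isUnit_Dn (g : TorusMap 2) (n : ℕ) (x : T2) : IsUnit (g.Dn n x) := by
  induction n generalizing x with
  | zero => exact isUnit_one
  | succ n ih => exact (ih (g.toFun x)).mul (g.isUnit_D x)

lemma Dninv_zero (g : TorusMap 2) (x : T2) (v : V2) : g.Dninv 0 x v = v := by
  have : g.Dninv 0 x = 1 := Ring.inverse_one _
  rw [this]; rfl

lemma Dninv_succ (g : TorusMap 2) (n : ℕ) (x : T2) (v : V2) :
    g.Dninv (n+1) x v = binv g x (g.Dninv n (g.toFun x) v) := by
  have : g.Dninv (n+1) x = binv g x * g.Dninv n (g.toFun x) :=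
    ring_inverse_mul _ _ (isUnit_Dn g n _) (g.isUnit_D x)
  rw [this]; rfl

/-- cocycle property -/
lemma Dninv_add (g : TorusMap 2) (m n : ℕ) (x : T2) (v : V2) :
    g.Dninv (n+m) x v = g.Dninv m x (g.Dninv n (g.toFun^[m] x) v) := by
  induction m generalizing x with
  | zero => simp [Dninv_zero]
  | succ m ih => rw [← add_assoc, Dninv_succ, ih, Dninv_succ, Function.iterate_succ_apply]

lemma Nice.Dninv_le {M : ℝ} {g : TorusMap 2} (h : Nice M g) (n : ℕ) (x : T2) (v : V2) :
    ‖g.Dninv n x v‖ ≤ M ^ n * ‖v‖ := by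
  induction n generalizing x with
  | zero => simp [Dninv_zero]
  | succ n ih =>
    rw [Dninv_succ, pow_succ']
    refine (h.binv_le _ _).trans ?_
    rw [mul_assoc]
    exact mul_le_mul_of_nonneg_left (ih _) (by linarith [h.one_le])

lemma Nice.le_Dninv {M : ℝ} {g : TorusMap 2} (h : Nice M g) (n : ℕ) (x : T2) (v : V2) :
    ‖v‖ ≤ M ^ n * ‖g.Dninv n x v‖ := by
  induction n generalizing x with
  | zero => simp [Dninv_zero]
  | succ n ih =>
    rw [Dninv_succ, pow_succ]
    refine (ih (g.toFun x)).trans ?_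
    rw [mul_assoc]
    exact mul_le_mul_of_nonneg_left (h.le_binv _ _) (pow_nonneg (by linarith [h.one_le]) _)

lemma F_diff (g : TorusMap 2) : Differentiable ℝ g.F := g.contDiff.differentiable (by norm_num)

lemma Nice.approx {M : ℝ} {g : TorusMap 2} (h : Nice M g) (p : V2) (ε : ℝ) (a b : V2)
    (ha : ‖a - p‖ ≤ ε) (hb : ‖b - p‖ ≤ ε) :
    ‖g.F a - g.F b - fderiv ℝ g.F p (a - b)‖ ≤ M * ε * ‖a - b‖ := by
  refine Convex.norm_image_sub_le_of_norm_fderiv_le' (𝕜 := ℝ) (s := Metric.closedBall p ε)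
    (fun x _ => F_diff g x) (fun x hx => ?_) (convex_closedBall _ _)
    (by simpa [dist_eq_norm] using hb) (by simpa [dist_eq_norm] using ha)
  refine (h.lip _ _).trans (mul_le_mul_of_nonneg_left ?_ (by linarith [h.one_le]))
  simpa [dist_eq_norm] using hx

lemma Nice.F_lip {M : ℝ} {g : TorusMap 2} (h : Nice M g) (a b : V2) :
    ‖g.F a - g.F b‖ ≤ M * ‖a - b‖ :=
  Convex.norm_image_sub_le_of_norm_fderiv_le (𝕜 := ℝ) (s := univ)
    (fun x _ => F_diff g x) (fun x _ => by rw [g.fderiv_eq_D]; exact h.bd _) convex_univ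
    (mem_univ _) (mem_univ _)

lemma Nice.surj_local {M : ℝ} {g : TorusMap 2} (h : Nice M g) (p c : V2) (ε : ℝ) (hε : 0 ≤ ε)
    (hs : 2 * M ^ 2 * ε ≤ 1) (hc : ‖c - g.F p‖ ≤ ε / (2 * M)) : ∃ p', ‖p' - p‖ ≤ ε ∧ g.F p' = c := by
  have hM := h.one_le
  have hM0 : 0 < M := by linarith
  have hA : ApproximatesLinearOn g.F (fderiv ℝ g.F p) (Metric.closedBall p ε)
      (Real.toNNReal (M * ε)) := by
    intro a ha b hb
    rw [Real.coe_toNNReal _ (by positivity)]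
    exact h.approx p ε a b (by simpa [dist_eq_norm] using ha) (by simpa [dist_eq_norm] using hb)
  have hR := hA.surjOn_closedBall_of_nonlinearRightInverse 
    (⟨binv g (proj p), Real.toNNReal M, fun y => by
      rw [Real.coe_toNNReal _ hM0.le]; exact h.binv_le _ _, fun y => by
      rw [g.fderiv_eq_D]; exact D_binv _ _ _⟩ : (fderiv ℝ g.F p).NonlinearRightInverse) hε subset_rfl
  obtain ⟨p', hp', hpc⟩ := hR (a := c) (by
    rw [Metric.mem_closedBall, dist_eq_norm]
    refine hc.trans ?_
    simp only
    rw [Real.coe_toNNReal _ hM0.le, Real.coe_toNNReal _ (by positivity)]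
    have h1 : M * ε ≤ 1 / (2 * M) := by
      rw [le_div_iff₀ (by positivity)]; nlinarith
    have h2 : 1 / (2 * M) ≤ M⁻¹ - M * ε := by
      have : M⁻¹ = 1 / (2 * M) + 1 / (2 * M) := by field_simp; norm_num
      linarith
    calc ε / (2 * M) = 1 / (2 * M) * ε := by ring
      _ ≤ _ := mul_le_mul_of_nonneg_right h2 hε)
  exact ⟨p', by simpa [dist_eq_norm] using hp', hpc⟩

lemma Nice.inj_local {M : ℝ} {g : TorusMap 2} (h : Nice M g) (a b : V2) (ε : ℝ)
    (hs : M ^ 2 * ε < 1) (hab : ‖a - b‖ ≤ ε) (hF : g.F a = g.F b) : a = b := by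
  have hM := h.one_le
  have hε : 0 ≤ ε := (norm_nonneg _).trans hab
  have h1 := h.approx b ε a b hab (by simpa using hε)
  rw [hF, sub_self, zero_sub, norm_neg, g.fderiv_eq_D] at h1
  have h2 := h.inv (proj b) (a - b)
  have h3 : ‖a - b‖ ≤ M ^ 2 * ε * ‖a - b‖ := by
    refine h2.trans ((mul_le_mul_of_nonneg_left h1 (by linarith)).trans (le_of_eq (by ring)))
  have h4 : ‖a - b‖ = 0 := by
    by_contra hne
    have : 0 < ‖a - b‖ := lt_of_le_of_ne (norm_nonneg _) (Ne.symm hne)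
    nlinarith
  exact sub_eq_zero.mp (norm_eq_zero.mp h4)

lemma Nice.inj_torus {M : ℝ} {g : TorusMap 2} (h : Nice M g) (y₁ y₂ : T2)
    (hd : dist y₁ y₂ ≤ 1 / (8 * M ^ 2)) (hg : g.toFun y₁ = g.toFun y₂) : y₁ = y₂ := by
  have hM := h.one_le
  obtain ⟨p, rfl⟩ := proj_surj y₂
  obtain ⟨q, rfl, hq⟩ := exists_lift_close p y₁
  have hM2 : 1 ≤ M ^ 2 := one_le_pow₀ hM
  have e : 2 * (1 / (8 * M ^ 2)) = 1 / (4 * M ^ 2) := by field_simp; norm_num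
  have hq' : ‖q - p‖ ≤ 1 / (4 * M ^ 2) := by rw [← e]; linarith
  rw [g.toFun_proj, g.toFun_proj] at hg
  obtain ⟨m, hm⟩ := proj_eq_imp hg
  have h1 : ‖iv m‖ < 1 := by
    have : iv m = - (g.F q - g.F p) := by rw [hm]; abel
    rw [this, norm_neg]
    refine (h.F_lip _ _).trans_lt ?_
    calc M * ‖q - p‖ ≤ M * (1 / (4 * M ^ 2)) := mul_le_mul_of_nonneg_left hq' (by linarith)
      _ = 1 / (4 * M) := by field_simp
      _ < 1 := by rw [div_lt_one (by linarith)]; linarith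
  rw [iv_zero_of_small h1, iv_zero, add_zero] at hm
  rw [h.inj_local q p _ (by
    have : M ^ 2 * (1 / (4 * M ^ 2)) = 1 / 4 := by field_simp
    rw [this]; norm_num) hq' hm.symm]

lemma Nice.inj_iter {M : ℝ} {g : TorusMap 2} (h : Nice M g) (N : ℕ) (y₁ y₂ : T2)
    (hd : ∀ k ≤ N, dist (g.toFun^[k] y₁) (g.toFun^[k] y₂) ≤ 1 / (8 * M ^ 2))
    (hg : g.toFun^[N] y₁ = g.toFun^[N] y₂) : y₁ = y₂ := by
  induction N generalizing y₁ y₂ with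
  | zero => simpa using hg
  | succ N ih =>
    refine h.inj_torus _ _ (by simpa using hd 0 (by omega)) (ih _ _ (fun k hk => ?_) ?_)
    · have := hd (k+1) (by omega)
      simpa only [Function.iterate_succ_apply] using this
    · simpa only [Function.iterate_succ_apply] using hg

lemma Nice.one_step {M : ℝ} {f : TorusMap 2} (h : Nice M f) (g : TorusMap 2) (η s : ℝ)
    (hη : ∀ x, dist (f.toFun x) (g.toFun x) ≤ η) (y x' : T2) (hx : dist x' (g.toFun y) ≤ s)
    (hsm : 8 * M ^ 3 * (s + η) ≤ 1) : ∃ y', f.toFun y' = x' ∧ dist y' y ≤ 4 * M * (s + η) := by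
  have hM := h.one_le
  obtain ⟨p, rfl⟩ := proj_surj y
  have hη0 : 0 ≤ η := dist_nonneg.trans (hη (proj p))
  have hs0 : 0 ≤ s := dist_nonneg.trans hx
  obtain ⟨c, rfl, hc⟩ := exists_lift_close (f.F p) x'
  rw [← f.toFun_proj] at hc
  have h1 : dist (proj c) (f.toFun (proj p)) ≤ s + η := by
    refine (dist_triangle _ (g.toFun (proj p)) _).trans (add_le_add hx ?_)
    rw [dist_comm]; exact hη _
  obtain ⟨p', hp', hF⟩ := h.surj_local p c (4 * M * (s + η)) (by positivity) (by nlinarith) (by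
    have : 4 * M * (s + η) / (2 * M) = 2 * (s + η) := by field_simp; ring
    rw [this]; linarith)
  exact ⟨proj p', by rw [f.toFun_proj, hF], (dist_proj_le _ _).trans hp'⟩

lemma match_iter (M : ℝ) (hM : 1 ≤ M) (N : ℕ) : ∀ ε : ℝ, 0 < ε → ∃ η : ℝ, 0 < η ∧ ∀ f g : TorusMap 2,
    Nice M f → (∀ x, dist (f.toFun x) (g.toFun x) ≤ η) → ∀ y x', dist x' (g.toFun^[N] y) ≤ η →
    ∃ y', f.toFun^[N] y' = x' ∧ ∀ k ≤ N, dist (f.toFun^[k] y') (g.toFun^[k] y) ≤ ε := by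
  induction N with
  | zero =>
    intro ε hε
    refine ⟨ε, hε, fun f g _ _ y x' hx => ⟨x', rfl, fun k hk => ?_⟩⟩
    obtain rfl : k = 0 := by omega
    simpa using hx
  | succ N ih =>
    intro ε hε
    set ε₁ := min (ε / (8 * M)) (1 / (16 * M ^ 3)) with hε₁
    have hε₁0 : 0 < ε₁ := lt_min (by positivity) (by positivity)
    obtain ⟨η₁, hη₁, H⟩ := ih ε₁ hε₁0
    refine ⟨min η₁ ε₁, lt_min hη₁ hε₁0, fun f g hf hfg y x' hx => ?_⟩
    obtain ⟨w, hw, hwk⟩ := H f g hf (fun x => (hfg x).trans (min_le_left _ _)) (g.toFun y) x'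
      (by simpa only [Function.iterate_succ_apply] using hx.trans (min_le_left _ _))
    have h1 : ε₁ ≤ ε / (8 * M) := min_le_left _ _
    have h2 : ε₁ ≤ 1 / (16 * M ^ 3) := min_le_right _ _
    rw [le_div_iff₀ (by positivity)] at h1 h2
    obtain ⟨y', hy', hd⟩ := hf.one_step g ε₁ ε₁ (fun x => (hfg x).trans (min_le_right _ _)) y w
      (by simpa using hwk 0 (by omega)) (by linarith)
    refine ⟨y', by rw [Function.iterate_succ_apply, hy', hw], fun k hk => ?_⟩
    rcases k with _ | k
    · simp only [Function.iterate_zero, id]; linarith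
    · rw [Function.iterate_succ_apply, Function.iterate_succ_apply, hy']
      refine (hwk k (by omega)).trans ?_
      nlinarith

lemma Nice.D_lip {M : ℝ} {g : TorusMap 2} (h : Nice M g) (x y : T2) :
    ‖g.D x - g.D y‖ ≤ M * (2 * dist x y) := by
  obtain ⟨p, rfl⟩ := proj_surj y
  obtain ⟨q, rfl, hq⟩ := exists_lift_close p x
  rw [← g.fderiv_eq_D, ← g.fderiv_eq_D]
  exact (h.lip _ _).trans (mul_le_mul_of_nonneg_left hq (by linarith [h.one_le]))

lemma binv_close (M : ℝ) (f g : TorusMap 2) (hf : Nice M f) (hg : Nice M g) (η : ℝ)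
    (hD : ∀ x, ‖f.D x - g.D x‖ ≤ η) (y' y : T2) (hd : dist y' y ≤ η) (w : V2) :
    ‖binv f y' w - binv g y w‖ ≤ 3 * M ^ 3 * η * ‖w‖ := by
  have hM := hf.one_le
  have hη : 0 ≤ η := dist_nonneg.trans hd
  have e : binv f y' w - binv g y w = binv f y' ((g.D y - f.D y') (binv g y w)) := by
    simp [D_binv, binv_D]
  have h1 : ‖g.D y - f.D y'‖ ≤ 3 * M * η := by
    have : g.D y - f.D y' = (f.D y - f.D y') - (f.D y - g.D y) := by abel
    rw [this]
    refine (norm_sub_le _ _).trans ?_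
    have := hf.D_lip y y'
    rw [dist_comm] at this
    have h2 : M * (2 * dist y' y) ≤ M * (2 * η) := mul_le_mul_of_nonneg_left (by linarith) (by linarith)
    nlinarith [hD y]
  rw [e]
  refine (hf.binv_le _ _).trans ?_
  have h3 := (g.D y - f.D y').le_of_opNorm_le h1 (binv g y w)
  have h4 := hg.binv_le y w
  calc M * ‖(g.D y - f.D y') (binv g y w)‖ ≤ M * (3 * M * η * (M * ‖w‖)) := by
        refine mul_le_mul_of_nonneg_left (h3.trans (mul_le_mul_of_nonneg_left h4 (by positivity))) (by linarith)
    _ = _ := by ring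

lemma Dninv_close (M : ℝ) (hM : 1 ≤ M) (N : ℕ) : ∀ ε : ℝ, 0 < ε → ∃ η : ℝ, 0 < η ∧ ∀ f g : TorusMap 2,
    Nice M f → Nice M g → (∀ x, ‖f.D x - g.D x‖ ≤ η) → ∀ y' y,
    (∀ k ≤ N, dist (f.toFun^[k] y') (g.toFun^[k] y) ≤ η) → ∀ v,
    ‖f.Dninv N y' v - g.Dninv N y v‖ ≤ ε * ‖v‖ := by
  induction N with
  | zero =>
    intro ε hε
    refine ⟨1, one_pos, fun f g _ _ _ y' y _ v => ?_⟩
    simp only [Dninv_zero, sub_self, norm_zero]; positivity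
  | succ N ih =>
    intro ε hε
    obtain ⟨η₁, hη₁, H⟩ := ih (ε / (2 * M)) (by positivity)
    refine ⟨min η₁ (ε / (6 * M ^ 3 * M ^ N)), lt_min hη₁ (by positivity), fun f g hf hg hD y' y hk v => ?_⟩
    have h1 := H f g hf hg (fun x => (hD x).trans (min_le_left _ _)) (f.toFun y') (g.toFun y)
      (fun k hkN => by
        have := hk (k+1) (by omega)
        simpa only [Function.iterate_succ_apply] using this.trans (min_le_left _ _)) v
    have h2 := binv_close M f g hf hg _ (fun x => (hD x).trans (min_le_right _ _)) y' y
      (by simpa using (hk 0 (by omega)).trans (min_le_right _ _)) (g.Dninv N (g.toFun y) v)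
    have h3 := hg.Dninv_le N (g.toFun y) v
    rw [Dninv_succ, Dninv_succ]
    set w' := f.Dninv N (f.toFun y') v
    set w := g.Dninv N (g.toFun y) v
    have e : binv f y' w' - binv g y w = binv f y' (w' - w) + (binv f y' w - binv g y w) := by
      rw [map_sub]; abel
    rw [e]
    refine (norm_add_le _ _).trans ?_
    have h4 := hf.binv_le y' (w' - w)
    have h5 : M * ‖w' - w‖ ≤ M * (ε / (2 * M) * ‖v‖) := mul_le_mul_of_nonneg_left h1 (by linarith)
    have h6 : M * (ε / (2 * M) * ‖v‖) = ε / 2 * ‖v‖ := by field_simp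
    have h7 : 3 * M ^ 3 * (ε / (6 * M ^ 3 * M ^ N)) * ‖w‖ ≤
        3 * M ^ 3 * (ε / (6 * M ^ 3 * M ^ N)) * (M ^ N * ‖v‖) :=
      mul_le_mul_of_nonneg_left h3 (by positivity)
    have h8 : 3 * M ^ 3 * (ε / (6 * M ^ 3 * M ^ N)) * (M ^ N * ‖v‖) = ε / 2 * ‖v‖ := by
      field_simp; ring
    linarith

lemma log_sub_le {a b c : ℝ} (hb : 0 < b) (ha : 0 < a) (hc : b⁻¹ ≤ c) :
    Real.log a - Real.log b ≤ c * |a - b| := by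
  rw [← Real.log_div ha.ne' hb.ne']
  refine (Real.log_le_sub_one_of_pos (by positivity)).trans ?_
  have : a / b - 1 = b⁻¹ * (a - b) := by field_simp
  rw [this]
  have h1 : b⁻¹ * (a - b) ≤ b⁻¹ * |a - b| := mul_le_mul_of_nonneg_left (le_abs_self _) (by positivity)
  exact h1.trans (mul_le_mul_of_nonneg_right hc (abs_nonneg _))

lemma log_close (M : ℝ) (hM : 1 ≤ M) (N : ℕ) : ∀ ε : ℝ, 0 < ε → ∃ η : ℝ, 0 < η ∧ ∀ f g : TorusMap 2,
    Nice M f → Nice M g → (∀ x, ‖f.D x - g.D x‖ ≤ η) → ∀ y' y,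
    (∀ k ≤ N, dist (f.toFun^[k] y') (g.toFun^[k] y) ≤ η) → ∀ v, ‖v‖ = 1 →
    Real.log ‖f.Dninv N y' v‖ ≤ Real.log ‖g.Dninv N y v‖ + ε := by
  intro ε hε
  obtain ⟨η, hη, H⟩ := Dninv_close M hM N (ε / M ^ N) (by positivity)
  refine ⟨η, hη, fun f g hf hg hD y' y hk v hv => ?_⟩
  have h1 := H f g hf hg hD y' y hk v
  have h2 := hf.le_Dninv N y' v
  have h3 := hg.le_Dninv N y v
  rw [hv] at h1 h2 h3
  have hMN : 0 < M ^ N := by positivity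
  have h2' : 0 < ‖f.Dninv N y' v‖ := by by_contra hh; nlinarith
  have h3' : 0 < ‖g.Dninv N y v‖ := by by_contra hh; nlinarith
  have h4 := log_sub_le h3' h2' (c := M ^ N) (by
    rw [inv_eq_one_div, div_le_iff₀ h3']; exact h3)
  have h5 : |‖f.Dninv N y' v‖ - ‖g.Dninv N y v‖| ≤ ε / M ^ N := by
    refine (abs_norm_sub_norm_le _ _).trans (by linarith)
  have h6 : M ^ N * |‖f.Dninv N y' v‖ - ‖g.Dninv N y v‖| ≤ M ^ N * (ε / M ^ N) :=
    mul_le_mul_of_nonneg_left h5 hMN.le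
  have h7 : M ^ N * (ε / M ^ N) = ε := by field_simp
  linarith

end

section

/-- every point of the backward tree of `z` has the right number of preimages -/
def Reg (g : TorusMap 2) (z : T2) : Prop :=
  ∀ m w, g.toFun^[m] w = z → ∀ k, ((g.toFun^[k]) ⁻¹' {w}).Finite ∧ ((g.toFun^[k]) ⁻¹' {w}).ncard = g.deg ^ k

lemma Reg.up {g : TorusMap 2} {z w : T2} (h : Reg g z) (m : ℕ) (hw : g.toFun^[m] w = z) : Reg g w := by
  intro m' w' hw' k
  refine h (m + m') w' ?_ k
  rw [Function.iterate_add_apply, hw', hw]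

lemma backward_iter {g : TorusMap 2} {x : T2} {ω : ℕ → T2} (h : IsBackward g x ω) (n m : ℕ) :
    g.toFun^[m] (ω (n + m)) = ω n := by
  induction m with
  | zero => rfl
  | succ m ih => rw [Function.iterate_succ_apply, ← add_assoc, h.2, ih]

lemma cyl_measurable {g : TorusMap 2} {x : T2} (n : ℕ) (z : T2) :
    MeasurableSet {ω : Bw g x | ω.1 n = z} := by
  have h : Measurable (fun ω : Bw g x => ω.1 n) :=
    (measurable_pi_apply n).comp measurable_subtype_coe
  exact h (measurableSet_singleton z)

lemma reg_of_bernoulli {g : TorusMap 2} (hd : 1 ≤ g.deg) {x : T2} {p : Measure (Bw g x)}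
    (hp : IsBernoulliBw g x p) : Reg g x := by
  intro n z hz m
  set d : ℝ≥0∞ := (g.deg : ℝ≥0∞) with hdd
  have hd0 : d ≠ 0 := by simp [hdd]; omega
  have hdt : d ≠ ⊤ := by simp [hdd]
  set S := (g.toFun^[m]) ⁻¹' {z} with hS
  have hmem : ∀ w ∈ S, g.toFun^[n + m] w = x := by
    intro w hw
    have : g.toFun^[m] w = z := hw
    rw [Function.iterate_add_apply, this, hz]
  have hcalc : ∀ c : ℕ, (c : ℝ≥0∞) * (d ^ (n + m))⁻¹ = c * (d ^ m)⁻¹ * (d ^ n)⁻¹ := by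
    intro c
    rw [pow_add, ENNReal.mul_inv (Or.inr (by finiteness)) (Or.inr (by simp [hd0]))]
    ring
  have hdn : (d ^ n)⁻¹ ≠ 0 := by simp [hdt]
  have hdn' : (d ^ n)⁻¹ ≠ ⊤ := by simp [hd0]
  have hdm0 : d ^ m ≠ 0 := by simp [hd0]
  have hdmt : d ^ m ≠ ⊤ := by finiteness
  have hup : ∀ s : Finset T2, (s : Set T2) ⊆ S → s.card ≤ g.deg ^ m := by
    intro s hs
    have h1 : p (⋃ w ∈ s, {ω : Bw g x | ω.1 (n + m) = w}) = ∑ w ∈ s, p {ω : Bw g x | ω.1 (n + m) = w} := by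
      apply measure_biUnion_finset
      · intro a _ b _ hab
        rw [Function.onFun, Set.disjoint_left]
        intro ω h1 h2
        exact hab (h1.symm.trans h2)
      · intro w _; exact cyl_measurable _ _
    rw [Finset.sum_congr rfl (fun w hw => hp.2 (n + m) w (hmem w (hs hw)))] at h1
    have h2 : p (⋃ w ∈ s, {ω : Bw g x | ω.1 (n + m) = w}) ≤ p {ω : Bw g x | ω.1 n = z} := by
      apply measure_mono
      intro ω hω
      simp only [mem_iUnion, mem_ofPred_eq] at hω ⊢
      obtain ⟨w, hw, hωw⟩ := hω
      rw [← backward_iter ω.2 n m, hωw]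
      exact hs hw
    rw [h1, hp.2 n z hz, Finset.sum_const, nsmul_eq_mul, hcalc] at h2
    have h3 : (s.card : ℝ≥0∞) * (d ^ m)⁻¹ ≤ 1 := by
      rw [← ENNReal.mul_le_mul_iff_left hdn hdn', one_mul]; exact h2
    rw [← div_eq_mul_inv, ENNReal.div_le_iff hdm0 hdmt, one_mul] at h3
    rw [hdd] at h3; exact_mod_cast h3
  have hfin : S.Finite := by
    by_contra hinf
    obtain ⟨t, ht, htc⟩ := Set.Infinite.exists_subset_card_eq hinf (g.deg ^ m + 1)
    have := hup t ht
    omega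
  refine ⟨hfin, le_antisymm ?_ ?_⟩
  · rw [Set.ncard_eq_toFinset_card S hfin]
    exact hup _ (by simp)
  · have h2 : p {ω : Bw g x | ω.1 n = z} ≤ p (⋃ w ∈ hfin.toFinset, {ω : Bw g x | ω.1 (n + m) = w}) := by
      apply measure_mono
      intro ω hω
      simp only [mem_iUnion, mem_ofPred_eq, Set.Finite.mem_toFinset] at hω ⊢
      refine ⟨ω.1 (n + m), ?_, rfl⟩
      show g.toFun^[m] (ω.1 (n + m)) = z
      rw [backward_iter ω.2 n m, hω]
    have h3 := h2.trans (measure_biUnion_finset_le _ _)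
    rw [Finset.sum_congr rfl (fun w hw => hp.2 (n + m) w (hmem w (by simpa using hw))), hp.2 n z hz,
      Finset.sum_const, nsmul_eq_mul, hcalc] at h3
    have h4 : 1 ≤ (hfin.toFinset.card : ℝ≥0∞) * (d ^ m)⁻¹ := by
      rw [← ENNReal.mul_le_mul_iff_left hdn hdn', one_mul]; exact h3
    rw [← div_eq_mul_inv, ENNReal.le_div_iff_mul_le (Or.inl hdm0) (Or.inl hdmt), one_mul] at h4
    rw [Set.ncard_eq_toFinset_card S hfin]
    rw [hdd] at h4; exact_mod_cast h4

open Classical in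
/-- the finite set of `n`-th preimages -/
def pre (g : TorusMap 2) (n : ℕ) (z : T2) : Finset T2 :=
  if h : ((g.toFun^[n]) ⁻¹' {z}).Finite then h.toFinset else ∅

lemma Reg.mem_pre {g : TorusMap 2} {z : T2} (h : Reg g z) (n : ℕ) (y : T2) :
    y ∈ pre g n z ↔ g.toFun^[n] y = z := by
  have hf := (h 0 z rfl n).1
  unfold pre
  rw [dif_pos hf]; simp

lemma Reg.card_pre {g : TorusMap 2} {z : T2} (h : Reg g z) (n : ℕ) :
    (pre g n z).card = g.deg ^ n := by
  have hf := (h 0 z rfl n).1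
  unfold pre
  rw [dif_pos hf, ← Set.ncard_eq_toFinset_card _ hf, (h 0 z rfl n).2]

lemma Reg.sum_pre {g : TorusMap 2} {z : T2} (h : Reg g z) (n m : ℕ) (φ : T2 → ℝ) :
    ∑ y ∈ pre g (n + m) z, φ y = ∑ w ∈ pre g n z, ∑ y ∈ pre g m w, φ y := by
  classical
  rw [← Finset.sum_fiberwise_of_maps_to (s := pre g (n+m) z) (t := pre g n z) (g := g.toFun^[m])]
  · refine Finset.sum_congr rfl fun w hw => ?_
    refine Finset.sum_congr ?_ fun _ _ => rfl
    rw [h.mem_pre] at hw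
    ext y
    rw [Finset.mem_filter, h.mem_pre, (h.up n hw).mem_pre, Function.iterate_add_apply]
    constructor
    · exact fun hh => hh.2
    · exact fun hh => ⟨by rw [hh, hw], hh⟩
  · intro y hy
    rw [h.mem_pre] at hy ⊢
    rwa [Function.iterate_add_apply] at hy

lemma C_pos (f : TorusMap 2) (hC : 0 < f.C) : ∃ N : ℕ, 1 ≤ N ∧ ∃ c : ℝ, 0 < c ∧
    ∀ x v, ‖v‖ = 1 → 2 * c ≤ f.I x v N := by
  unfold TorusMap.C at hC
  rw [Filter.liminf_eq] at hC
  have hne : {a : ℝ | ∀ᶠ n : ℕ in atTop, a ≤ f.unifInf n / n}.Nonempty := by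
    by_contra hh
    rw [Set.not_nonempty_iff_eq_empty] at hh
    rw [hh, Real.sSup_empty] at hC
    exact lt_irrefl _ hC
  obtain ⟨a, ha, ha0⟩ := exists_lt_of_lt_csSup hne hC
  obtain ⟨N, hN1, hN⟩ := ((eventually_ge_atTop 1).and ha).exists
  have hNpos : (0:ℝ) < N := by exact_mod_cast hN1
  rw [le_div_iff₀ hNpos] at hN
  refine ⟨N, hN1, a * N / 2, by positivity, fun x v hv => ?_⟩
  have hb : BddBelow (range fun xv : T2 × Metric.sphere (0 : V2) 1 => f.I xv.1 (xv.2 : V2) N) := by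
    by_contra hh
    have : f.unifInf N = 0 := Real.iInf_of_not_bddBelow hh
    rw [this] at hN
    have : 0 < a * N := by positivity
    linarith
  have h1 : f.unifInf N ≤ f.I x v N :=
    ciInf_le hb (⟨x, ⟨v, by simpa using hv⟩⟩ : T2 × Metric.sphere (0 : V2) 1)
  linarith

lemma transfer (M : ℝ) (f : TorusMap 2) (hf : Nice M f) (hd : 1 ≤ f.deg) (N : ℕ) (c : ℝ) (hc : 0 < c)
    (hI : ∀ x v, ‖v‖ = 1 → 2 * c ≤ f.I x v N) : ∃ η : ℝ, 0 < η ∧ ∀ g : TorusMap 2, Nice M g →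
    (∀ x, dist (f.toFun x) (g.toFun x) ≤ η) → (∀ x, ‖f.D x - g.D x‖ ≤ η) → g.deg = f.deg →
    ∀ z, Reg g z → ∀ v, ‖v‖ = 1 → c * (g.deg : ℝ) ^ N ≤ ∑ y ∈ pre g N z, Real.log ‖g.Dninv N y v‖ := by
  classical
  have hM := hf.one_le
  obtain ⟨η₁, hη₁, H1⟩ := log_close M hM N c hc
  obtain ⟨η₂, hη₂, H2⟩ := match_iter M hM N (min η₁ (1 / (16 * M ^ 2))) (lt_min hη₁ (by positivity))
  refine ⟨min η₁ η₂, lt_min hη₁ hη₂, fun g hg hfg hD hdeg z hz v hv => ?_⟩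
  have hr : 1 / (16 * M ^ 2) + 1 / (16 * M ^ 2) = 1 / (8 * M ^ 2) := by field_simp; norm_num
  -- matching from g to f
  have A : ∀ y, ∃ y', g.toFun^[N] y = z → (f.toFun^[N] y' = z ∧
      ∀ k ≤ N, dist (f.toFun^[k] y') (g.toFun^[k] y) ≤ min η₁ (1 / (16 * M ^ 2))) := by
    intro y
    by_cases hy : g.toFun^[N] y = z
    · obtain ⟨y', h1, h2⟩ := H2 f g hf (fun x => (hfg x).trans (min_le_right _ _)) y z
        (by rw [hy, dist_self]; exact hη₂.le)
      exact ⟨y', fun _ => ⟨h1, h2⟩⟩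
    · exact ⟨y, fun h => absurd h hy⟩
  have B : ∀ y, ∃ y', f.toFun^[N] y = z → (g.toFun^[N] y' = z ∧
      ∀ k ≤ N, dist (g.toFun^[k] y') (f.toFun^[k] y) ≤ min η₁ (1 / (16 * M ^ 2))) := by
    intro y
    by_cases hy : f.toFun^[N] y = z
    · obtain ⟨y', h1, h2⟩ := H2 g f hg (fun x => by rw [dist_comm]; exact (hfg x).trans (min_le_right _ _)) y z
        (by rw [hy, dist_self]; exact hη₂.le)
      exact ⟨y', fun _ => ⟨h1, h2⟩⟩
    · exact ⟨y, fun h => absurd h hy⟩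
  choose φ hφ using A
  choose ψ hψ using B
  have hφinj : ∀ a b, g.toFun^[N] a = z → g.toFun^[N] b = z → φ a = φ b → a = b := by
    intro a b ha hb hab
    refine hg.inj_iter N a b (fun k hk => ?_) (by rw [ha, hb])
    have h1 := ((hφ a ha).2 k hk).trans (min_le_right _ _)
    have h2 := ((hφ b hb).2 k hk).trans (min_le_right _ _)
    rw [← hab] at h2
    rw [← hr]
    refine (dist_triangle_left _ _ _).trans (add_le_add h1 h2)
  have hψinj : ∀ a b, f.toFun^[N] a = z → f.toFun^[N] b = z → ψ a = ψ b → a = b := by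
    intro a b ha hb hab
    refine hf.inj_iter N a b (fun k hk => ?_) (by rw [ha, hb])
    have h1 := ((hψ a ha).2 k hk).trans (min_le_right _ _)
    have h2 := ((hψ b hb).2 k hk).trans (min_le_right _ _)
    rw [← hab] at h2
    rw [← hr]
    refine (dist_triangle_left _ _ _).trans (add_le_add h1 h2)
  have hSf : ((f.toFun^[N]) ⁻¹' {z}).Finite := by
    refine Set.Finite.of_finite_image (f := ψ) ((pre g N z).finite_toSet.subset ?_) ?_
    · rintro _ ⟨y, hy, rfl⟩
      exact (hz.mem_pre N _).mpr (hψ y hy).1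
    · intro a ha b hb hab; exact hψinj a b ha hb hab
  have hcard : hSf.toFinset.card ≤ (pre g N z).card := by
    refine Finset.card_le_card_of_injOn ψ (fun y hy => ?_) (fun a ha b hb hab => ?_)
    · exact (hz.mem_pre N _).mpr (hψ y (by simpa using hy)).1
    · exact hψinj a b (by simpa using ha) (by simpa using hb) hab
  have hinj : Set.InjOn φ (pre g N z : Set T2) := by
    intro a ha b hb hab
    exact hφinj a b ((hz.mem_pre N _).mp ha) ((hz.mem_pre N _).mp hb) hab
  have himg : (pre g N z).image φ = hSf.toFinset := by
    refine Finset.eq_of_subset_of_card_le (fun y' hy' => ?_) ?_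
    · rw [Finset.mem_image] at hy'
      obtain ⟨y, hy, rfl⟩ := hy'
      have := (hφ y ((hz.mem_pre N _).mp hy)).1
      simpa using this
    · rw [Finset.card_image_of_injOn hinj]; exact hcard
  have hIz := hI z v hv
  unfold TorusMap.I at hIz
  rw [finsum_mem_eq_finite_toFinset_sum _ hSf, ← himg, Finset.sum_image hinj] at hIz
  have hdpos : (0:ℝ) < (f.deg : ℝ) ^ N := by positivity
  rw [inv_mul_eq_div, le_div_iff₀ hdpos] at hIz
  have hle : ∑ y ∈ pre g N z, Real.log ‖f.Dninv N (φ y) v‖ ≤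
      ∑ y ∈ pre g N z, (Real.log ‖g.Dninv N y v‖ + c) := by
    refine Finset.sum_le_sum fun y hy => ?_
    have hy' := hφ y ((hz.mem_pre N _).mp hy)
    exact H1 f g hf hg (fun x => (hD x).trans (min_le_left _ _)) (φ y) y
      (fun k hk => (hy'.2 k hk).trans (min_le_left _ _)) v hv
  rw [Finset.sum_add_distrib, Finset.sum_const, nsmul_eq_mul, hz.card_pre, hdeg] at hle
  rw [hdeg]
  push_cast at hle
  linarith

lemma Nice.abs_log_le {M : ℝ} {g : TorusMap 2} (h : Nice M g) (n : ℕ) (y : T2) (v : V2) (hv : v ≠ 0) :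
    |Real.log ‖g.Dninv n y v‖ - Real.log ‖v‖| ≤ n * Real.log M := by
  have hM := h.one_le
  have hv' : 0 < ‖v‖ := norm_pos_iff.mpr hv
  have h1 := h.Dninv_le n y v
  have h2 := h.le_Dninv n y v
  have hMn : 0 < M ^ n := by positivity
  have h3 : 0 < ‖g.Dninv n y v‖ := by by_contra hh; nlinarith
  have l1 := Real.log_le_log h3 h1
  have l2 := Real.log_le_log hv' h2
  rw [Real.log_mul hMn.ne' hv'.ne', Real.log_pow] at l1
  rw [Real.log_mul hMn.ne' h3.ne', Real.log_pow] at l2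
  rw [abs_le]; constructor <;> linarith

lemma Nice.Dninv_ne {M : ℝ} {g : TorusMap 2} (h : Nice M g) (n : ℕ) (y : T2) (v : V2) (hv : v ≠ 0) :
    g.Dninv n y v ≠ 0 := by
  intro h0
  have h2 := h.le_Dninv n y v
  rw [h0, norm_zero, mul_zero] at h2
  exact hv (norm_le_zero_iff.mp h2)

/-- moment sum -/
def W (g : TorusMap 2) (s : ℝ) (n : ℕ) (z : T2) (v : V2) : ℝ :=
  ∑ y ∈ pre g n z, Real.exp (-s * (Real.log ‖g.Dninv n y v‖ - Real.log ‖v‖))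

lemma W_block {M : ℝ} {g : TorusMap 2} (hg : Nice M g) (N : ℕ) (c : ℝ) (hc : 0 < c) (L s : ℝ)
    (hL1 : 1 ≤ L) (hL : N * Real.log M ≤ L) (hs : 0 < s) (hs1 : s * L ≤ 1) (hs2 : s * L ^ 2 ≤ c / 2)
    (z : T2) (hz : Reg g z)
    (hI : ∀ v, ‖v‖ = 1 → c * (g.deg : ℝ) ^ N ≤ ∑ y ∈ pre g N z, Real.log ‖g.Dninv N y v‖)
    (v : V2) (hv : v ≠ 0) : W g s N z v ≤ (g.deg : ℝ) ^ N * Real.exp (-(s * c / 2)) := by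
  have hv' : 0 < ‖v‖ := norm_pos_iff.mpr hv
  have hI' : c * (g.deg : ℝ) ^ N ≤ ∑ y ∈ pre g N z, (Real.log ‖g.Dninv N y v‖ - Real.log ‖v‖) := by
    refine (hI (‖v‖⁻¹ • v) (by rw [norm_smul]; simp [hv'.ne'])).trans (le_of_eq ?_)
    refine Finset.sum_congr rfl fun y _ => ?_
    have : 0 < ‖g.Dninv N y v‖ := norm_pos_iff.mpr (hg.Dninv_ne N y v hv)
    rw [map_smul, norm_smul, norm_inv, norm_norm, Real.log_mul (by positivity) this.ne', Real.log_inv]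
    ring
  have hterm : ∀ y, Real.exp (-s * (Real.log ‖g.Dninv N y v‖ - Real.log ‖v‖)) ≤
      1 - s * (Real.log ‖g.Dninv N y v‖ - Real.log ‖v‖) + s ^ 2 * L ^ 2 := by
    intro y
    set t := Real.log ‖g.Dninv N y v‖ - Real.log ‖v‖
    have ht : |t| ≤ L := (hg.abs_log_le N y v hv).trans hL
    have hst : |-s * t| ≤ 1 := by
      rw [abs_mul, abs_neg, abs_of_pos hs]
      exact (mul_le_mul_of_nonneg_left ht hs.le).trans hs1
    have h1 := Real.abs_exp_sub_one_sub_id_le hst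
    have h2 := (abs_le.mp h1).2
    have h3 : (-s * t) ^ 2 ≤ s ^ 2 * L ^ 2 := by
      rw [mul_pow, neg_sq]
      exact mul_le_mul_of_nonneg_left (sq_le_sq' (by linarith [(abs_le.mp ht).1]) (abs_le.mp ht).2) (by positivity)
    linarith
  have hsum : W g s N z v ≤ ∑ y ∈ pre g N z,
      (1 - s * (Real.log ‖g.Dninv N y v‖ - Real.log ‖v‖) + s ^ 2 * L ^ 2) :=
    Finset.sum_le_sum fun y _ => hterm y
  rw [Finset.sum_add_distrib, Finset.sum_sub_distrib, ← Finset.mul_sum, Finset.sum_const,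
    Finset.sum_const, nsmul_eq_mul, nsmul_eq_mul, hz.card_pre] at hsum
  push_cast at hsum
  have hdN : 0 ≤ (g.deg : ℝ) ^ N := by positivity
  have h5 := mul_le_mul_of_nonneg_left hI' hs.le
  have h6 : 1 - s * c / 2 ≤ Real.exp (-(s * c / 2)) := by
    have := Real.add_one_le_exp (-(s * c / 2)); linarith
  have h7 : s ^ 2 * L ^ 2 ≤ s * c / 2 := by nlinarith
  have h8 := mul_le_mul_of_nonneg_left h6 hdN
  have h9 := mul_le_mul_of_nonneg_left h7 hdN
  nlinarith

lemma W_step {M : ℝ} {g : TorusMap 2} (hg : Nice M g) (s : ℝ) (n N : ℕ) (z : T2) (hz : Reg g z) (a : ℝ)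
    (hW : ∀ w, Reg g w → ∀ v, v ≠ 0 → W g s N w v ≤ a) (v : V2) (hv : v ≠ 0) :
    W g s (n + N) z v ≤ a * W g s n z v := by
  unfold W
  rw [hz.sum_pre n N, Finset.mul_sum]
  refine Finset.sum_le_sum fun w hw => ?_
  rw [hz.mem_pre] at hw
  have hRw := hz.up n hw
  set u := g.Dninv n w v
  have hu : u ≠ 0 := hg.Dninv_ne n w v hv
  have h1 : ∑ y ∈ pre g N w, Real.exp (-s * (Real.log ‖g.Dninv (n + N) y v‖ - Real.log ‖v‖)) =
      W g s N w u * Real.exp (-s * (Real.log ‖u‖ - Real.log ‖v‖)) := by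
    unfold W
    rw [Finset.sum_mul]
    refine Finset.sum_congr rfl fun y hy => ?_
    rw [hRw.mem_pre] at hy
    rw [Dninv_add, hy, ← Real.exp_add]
    congr 1; ring
  rw [h1]
  exact mul_le_mul_of_nonneg_right (hW w hRw u hu) (Real.exp_pos _).le

lemma W_le {M : ℝ} {g : TorusMap 2} (hg : Nice M g) (s : ℝ) (hs : 0 < s) (N : ℕ) (hN : 1 ≤ N)
    (κ : ℝ) (hκ : 0 < κ)
    (hW : ∀ w, Reg g w → ∀ v, v ≠ 0 → W g s N w v ≤ (g.deg : ℝ) ^ N * Real.exp (-(κ * N)))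
    (n : ℕ) : ∀ z, Reg g z → ∀ v, v ≠ 0 →
    W g s n z v ≤ Real.exp (s * (N * Real.log M) + κ * N) * (g.deg : ℝ) ^ n * Real.exp (-(κ * n)) := by
  induction n using Nat.strong_induction_on with
  | _ n ih =>
    intro z hz v hv
    have hd0 : (0:ℝ) ≤ (g.deg : ℝ) := by positivity
    rcases lt_or_ge n N with h | h
    · have hnN : (n:ℝ) ≤ N := by exact_mod_cast h.le
      have hlog : 0 ≤ Real.log M := Real.log_nonneg hg.one_le
      have : W g s n z v ≤ ∑ y ∈ pre g n z, Real.exp (s * (N * Real.log M)) := by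
        refine Finset.sum_le_sum fun y _ => Real.exp_le_exp.mpr ?_
        have h1 := (abs_le.mp (hg.abs_log_le n y v hv)).1
        have h2 : (n:ℝ) * Real.log M ≤ N * Real.log M := mul_le_mul_of_nonneg_right hnN hlog
        nlinarith
      rw [Finset.sum_const, nsmul_eq_mul, hz.card_pre] at this
      push_cast at this
      refine this.trans ?_
      have e : Real.exp (s * (N * Real.log M) + κ * N) * (g.deg : ℝ) ^ n * Real.exp (-(κ * n)) =
        (g.deg : ℝ) ^ n * Real.exp (s * (N * Real.log M) + κ * N + -(κ * n)) := by
        rw [Real.exp_add _ (-(κ * n))]; ring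
      rw [e]
      refine mul_le_mul_of_nonneg_left (Real.exp_le_exp.mpr ?_) (by positivity)
      nlinarith
    · obtain ⟨k, rfl⟩ : ∃ k, n = k + N := ⟨n - N, by omega⟩
      have h1 := W_step hg s k N z hz _ hW v hv
      have h2 := ih k (by omega) z hz v hv
      refine h1.trans ((mul_le_mul_of_nonneg_left h2 (by positivity)).trans (le_of_eq ?_))
      have e : Real.exp (-(κ * ((k + N : ℕ) : ℝ))) = Real.exp (-(κ * N)) * Real.exp (-(κ * k)) := by
        rw [← Real.exp_add]; congr 1; push_cast; ring
      rw [e, pow_add]; ring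

lemma moment (M : ℝ) (f : TorusMap 2) (hf : Nice M f) (hd : 1 ≤ f.deg) (hC : 0 < f.C) :
    ∃ s κ K η : ℝ, 0 < s ∧ 0 < κ ∧ 0 < K ∧ 0 < η ∧ ∀ g : TorusMap 2, Nice M g →
    (∀ x, dist (f.toFun x) (g.toFun x) ≤ η) → (∀ x, ‖f.D x - g.D x‖ ≤ η) → g.deg = f.deg →
    ∀ n z, Reg g z → ∀ v, v ≠ 0 → W g s n z v ≤ K * (g.deg : ℝ) ^ n * Real.exp (-(κ * n)) := by
  obtain ⟨N, hN, c, hc, hI⟩ := C_pos f hC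
  obtain ⟨η, hη, H⟩ := transfer M f hf hd N c hc hI
  have hlog : 0 ≤ Real.log M := Real.log_nonneg hf.one_le
  set L : ℝ := N * Real.log M + 1 with hLdef
  have hL1 : 1 ≤ L := by
    have : 0 ≤ (N:ℝ) * Real.log M := by positivity
    linarith
  set s : ℝ := min (1 / L) (c / (2 * L ^ 2)) with hsdef
  have hs : 0 < s := lt_min (by positivity) (by positivity)
  have hs1 : s * L ≤ 1 := by
    have : s ≤ 1 / L := min_le_left _ _
    rwa [le_div_iff₀ (by positivity)] at this
  have hs2 : s * L ^ 2 ≤ c / 2 := by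
    have : s ≤ c / (2 * L ^ 2) := min_le_right _ _
    rw [le_div_iff₀ (by positivity)] at this
    linarith
  have hN0 : (0:ℝ) < N := by exact_mod_cast hN
  refine ⟨s, s * c / 2 / N, Real.exp (s * (N * Real.log M) + s * c / 2 / N * N), η, hs, by positivity,
    Real.exp_pos _, hη, fun g hg h1 h2 h3 n z hz v hv => ?_⟩
  refine W_le hg s hs N hN _ (by positivity) (fun w hw u hu => ?_) n z hz v hv
  have e : s * c / 2 / N * N = s * c / 2 := by field_simp
  rw [e]
  exact W_block hg N c hc L s hL1 (by linarith) hs hs1 hs2 w hw (H g hg h1 h2 h3 w hw) u hu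

end

section

/-- logarithmic growth of a fixed vector along a backward orbit -/
def Sg (g : TorusMap 2) (ω : ℕ → T2) (n : ℕ) : ℝ := Real.log ‖g.Dninv n (ω n) (ev2 0)‖

lemma ev2_ne (i : Fin 2) : ev2 i ≠ 0 := by
  intro h
  have := ev2_norm i
  rw [h, norm_zero] at this
  exact zero_ne_one this

lemma bad_bound {M s κ' K : ℝ} (hs : 0 < s) (hK : 0 < K) {g : TorusMap 2} (hg : Nice M g)
    (hd : 1 ≤ g.deg)
    (hW : ∀ n z, Reg g z → ∀ v, v ≠ 0 → W g s n z v ≤ K * (g.deg : ℝ) ^ n * Real.exp (-(κ' * n)))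
    {x : T2} {p : Measure (Bw g x)} (hp : IsBernoulliBw g x p) (m k : ℕ) (c : ℝ) :
    p {ω : Bw g x | Sg g ω.1 (m + k) - Sg g ω.1 m < c} ≤
      ENNReal.ofReal (K * Real.exp (-(κ' * k) + s * c)) := by
  classical
  have hR := reg_of_bernoulli hd hp
  set Z := (pre g (m + k) x).filter (fun y => Real.log ‖g.Dninv (m + k) y (ev2 0)‖ -
    Real.log ‖g.Dninv m (g.toFun^[k] y) (ev2 0)‖ < c) with hZ
  have hd0 : (0:ℝ) < (g.deg : ℝ) := by exact_mod_cast hd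
  have h1 : p {ω : Bw g x | Sg g ω.1 (m + k) - Sg g ω.1 m < c} ≤
      p (⋃ y ∈ Z, {ω : Bw g x | ω.1 (m + k) = y}) := by
    apply measure_mono
    intro ω hω
    simp only [mem_iUnion, mem_ofPred_eq] at hω ⊢
    refine ⟨ω.1 (m + k), ?_, rfl⟩
    rw [hZ, Finset.mem_filter, hR.mem_pre]
    have e0 := backward_iter ω.2 0 (m + k)
    rw [zero_add, ω.2.1] at e0
    refine ⟨e0, ?_⟩
    rw [backward_iter ω.2 m k]
    exact hω
  have h2 := h1.trans (measure_biUnion_finset_le _ _)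
  rw [Finset.sum_congr rfl (fun y hy => hp.2 (m + k) y (((hR.mem_pre _ _).mp (Finset.mem_filter.mp hy).1))),
    Finset.sum_const, nsmul_eq_mul] at h2
  refine h2.trans ?_
  have e1 : (Z.card : ℝ≥0∞) * ((g.deg : ℝ≥0∞) ^ (m + k))⁻¹ =
      ENNReal.ofReal (Z.card / (g.deg : ℝ) ^ (m + k)) := by
    rw [ENNReal.ofReal_div_of_pos (by positivity), div_eq_mul_inv, ENNReal.ofReal_pow hd0.le,
      ENNReal.ofReal_natCast, ENNReal.ofReal_natCast]
  rw [e1]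
  apply ENNReal.ofReal_le_ofReal
  rw [div_le_iff₀ (by positivity)]
  have h3 : (Z.card : ℝ) * Real.exp (-s * c) ≤ ∑ y ∈ pre g (m + k) x,
      Real.exp (-s * (Real.log ‖g.Dninv (m + k) y (ev2 0)‖ -
    Real.log ‖g.Dninv m (g.toFun^[k] y) (ev2 0)‖)) := by
    have : (Z.card : ℝ) * Real.exp (-s * c) = ∑ y ∈ Z, Real.exp (-s * c) := by
      rw [Finset.sum_const, nsmul_eq_mul]
    rw [this]
    refine (Finset.sum_le_sum (fun y hy => ?_)).trans
      (Finset.sum_le_sum_of_subset_of_nonneg (Finset.filter_subset _ _) (fun _ _ _ => (Real.exp_pos _).le))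
    have := (Finset.mem_filter.mp hy).2
    apply Real.exp_le_exp.mpr
    nlinarith
  rw [hR.sum_pre m k] at h3
  have h4 : ∀ w ∈ pre g m x, ∑ y ∈ pre g k w, Real.exp (-s * (Real.log ‖g.Dninv (m + k) y (ev2 0)‖ -
    Real.log ‖g.Dninv m (g.toFun^[k] y) (ev2 0)‖)) ≤ K * (g.deg : ℝ) ^ k * Real.exp (-(κ' * k)) := by
    intro w hw
    have hRw := hR.up m ((hR.mem_pre _ _).mp hw)
    refine le_trans (le_of_eq ?_) (hW k w hRw (g.Dninv m w (ev2 0)) (hg.Dninv_ne m w _ (ev2_ne 0)))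
    unfold W
    refine Finset.sum_congr rfl fun y hy => ?_
    rw [hRw.mem_pre] at hy
    rw [Dninv_add, hy]
  have h5 := h3.trans (Finset.sum_le_sum h4)
  rw [Finset.sum_const, nsmul_eq_mul, hR.card_pre] at h5
  push_cast at h5
  have h6 : Real.exp (-s * c) * Real.exp (s * c) = 1 := by rw [← Real.exp_add]; simp
  have h7 := mul_le_mul_of_nonneg_right h5 (Real.exp_pos (s * c)).le
  rw [mul_assoc, h6, mul_one] at h7
  refine h7.trans (le_of_eq ?_)
  rw [Real.exp_add, pow_add]; ring

lemma good_measure (s κ' K δ : ℝ) (hs : 0 < s) (hκ' : 0 < κ') (hK : 0 < K) (hδ : 0 < δ) :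
    ∃ R : ℝ, 0 ≤ R ∧ ∀ (M : ℝ) (g : TorusMap 2), Nice M g → 1 ≤ g.deg →
    (∀ n z, Reg g z → ∀ v, v ≠ 0 → W g s n z v ≤ K * (g.deg : ℝ) ^ n * Real.exp (-(κ' * n))) →
    ∀ (x : T2) (p : Measure (Bw g x)), IsBernoulliBw g x p →
    ENNReal.ofReal (1 - δ) < p {ω : Bw g x | ∀ m k : ℕ,
      (κ' / (2 * s)) * k - (κ' / (2 * s) / 6) * m - R ≤ Sg g ω.1 (m + k) - Sg g ω.1 m} := by
  set κ := κ' / (2 * s) with hκ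
  have hκ0 : 0 < κ := by positivity
  set δ' := min δ 1 with hδ'
  have hδ0 : 0 < δ' := lt_min hδ one_pos
  set a : ℝ≥0∞ := ENNReal.ofReal (Real.exp (-(κ' / 2))) with ha
  set b : ℝ≥0∞ := ENNReal.ofReal (Real.exp (-(s * (κ / 6)))) with hb
  have ha1 : a < 1 := by
    rw [ha, ENNReal.ofReal_lt_one]; apply Real.exp_lt_one_iff.mpr; linarith
  have hb1 : b < 1 := by
    rw [hb, ENNReal.ofReal_lt_one]; apply Real.exp_lt_one_iff.mpr
    have : 0 < s * (κ / 6) := by positivity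
    linarith
  set A : ℝ≥0∞ := (1 - a)⁻¹ * (1 - b)⁻¹ with hA
  have hAt : A ≠ ⊤ := by
    rw [hA]
    refine ENNReal.mul_ne_top ?_ ?_
    · rw [ENNReal.inv_ne_top]; exact (tsub_pos_of_lt ha1).ne'
    · rw [ENNReal.inv_ne_top]; exact (tsub_pos_of_lt hb1).ne'
  set A' := A.toReal with hA'
  have hA'0 : 0 ≤ A' := ENNReal.toReal_nonneg
  set X := K * (A' + 1) / δ' with hX
  have hX0 : 0 < X := by positivity
  refine ⟨X / s, by positivity, fun M g hg hd hW x p hp => ?_⟩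
  have hbad : p {ω : Bw g x | ∀ m k : ℕ,
      κ * k - (κ / 6) * m - X / s ≤ Sg g ω.1 (m + k) - Sg g ω.1 m}ᶜ < ENNReal.ofReal δ' := by
    have h1 : {ω : Bw g x | ∀ m k : ℕ,
      κ * k - (κ / 6) * m - X / s ≤ Sg g ω.1 (m + k) - Sg g ω.1 m}ᶜ ⊆
      ⋃ m : ℕ, ⋃ k : ℕ, {ω : Bw g x | Sg g ω.1 (m + k) - Sg g ω.1 m < κ * k - (κ / 6) * m - X / s} := by
      intro ω hω
      simp only [mem_compl_iff, mem_ofPred_eq, not_forall, not_le, mem_iUnion] at hω ⊢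
      exact hω
    have h2 : p {ω : Bw g x | ∀ m k : ℕ,
      κ * k - (κ / 6) * m - X / s ≤ Sg g ω.1 (m + k) - Sg g ω.1 m}ᶜ ≤
        ∑' m : ℕ, ∑' k : ℕ, ENNReal.ofReal (K * Real.exp (-X)) * (b ^ m * a ^ k) := by
      refine (measure_mono h1).trans ((measure_iUnion_le _).trans (ENNReal.tsum_le_tsum fun m => ?_))
      refine (measure_iUnion_le _).trans (ENNReal.tsum_le_tsum fun k => ?_)
      refine (bad_bound hs hK hg hd hW hp m k _).trans (le_of_eq ?_)
      rw [ha, hb, ← ENNReal.ofReal_pow (Real.exp_pos _).le, ← ENNReal.ofReal_pow (Real.exp_pos _).le,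
        ← ENNReal.ofReal_mul (by positivity), ← ENNReal.ofReal_mul (by positivity),
        ← Real.exp_nat_mul, ← Real.exp_nat_mul, mul_assoc, ← Real.exp_add, ← Real.exp_add]
      congr 3
      rw [hκ]; field_simp; ring
    refine h2.trans_lt ?_
    simp_rw [ENNReal.tsum_mul_left, ENNReal.tsum_mul_right, ENNReal.tsum_geometric]
    rw [mul_comm (1 - b)⁻¹, ← hA, ← ENNReal.ofReal_toReal hAt, ← ENNReal.ofReal_mul (by positivity)]
    rw [ENNReal.ofReal_lt_ofReal_iff hδ0]
    have h3 := Real.add_one_le_exp X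
    have h4 : Real.exp (-X) * Real.exp X = 1 := by rw [← Real.exp_add]; simp
    have h5 : Real.exp (-X) * X < 1 := by nlinarith [Real.exp_pos (-X)]
    have h6 : K * (A' + 1) = δ' * X := by rw [hX]; field_simp
    have h7 := Real.exp_pos (-X)
    have : K * Real.exp (-X) * A' ≤ Real.exp (-X) * (K * (A' + 1)) := by nlinarith [mul_pos hK h7]
    rw [h6] at this
    nlinarith
  haveI := hp.1
  by_contra hcon
  rw [not_lt] at hcon
  set G := {ω : Bw g x | ∀ m k : ℕ,
      κ * k - (κ / 6) * m - X / s ≤ Sg g ω.1 (m + k) - Sg g ω.1 m}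
  have h8 : (1 : ℝ≥0∞) ≤ p G + p Gᶜ := by
    rw [← measure_univ (μ := p), ← Set.union_compl_self G]
    exact measure_union_le _ _
  have h9 : p G + p Gᶜ < ENNReal.ofReal (1 - δ) + ENNReal.ofReal δ' :=
    ENNReal.add_lt_add_of_le_of_lt (measure_ne_top _ _) hcon hbad
  have h10 : ENNReal.ofReal (1 - δ) + ENNReal.ofReal δ' ≤ 1 := by
    rcases le_total δ 1 with h | h
    · rw [← ENNReal.ofReal_add (by linarith) hδ0.le, hδ', min_eq_left h]; simp
    · rw [ENNReal.ofReal_of_nonpos (by linarith), zero_add, hδ', min_eq_right h]; simp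
  exact absurd (h8.trans_lt (h9.trans_le h10)) (lt_irrefl _)

end

section

lemma weights_alpha (S : ℕ → ℝ) (ε R : ℝ) (hε : 0 < ε)
    (h : ∀ m k : ℕ, 6 * ε * k - ε * m - R ≤ S (m + k) - S m) :
    ∃ α : ℕ → ℝ, (∀ n : ℕ, Real.exp (-(3 * ε * n)) ≤ α n) ∧ (∀ n : ℕ, α n ≤ Real.exp (R - 2 * ε * n)) ∧
      ∀ n, α (n + 1) ≤ Real.exp (-(3 * ε)) * Real.exp (S (n + 1) - S n) * α n := by
  set τ : ℕ → ℕ → ℝ := fun n k => Real.exp (-(S (n + k) - S n) + 3 * ε * k - 3 * ε * (n + k)) with hτ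
  have hb : ∀ n k, τ n k ≤ Real.exp (R - 2 * ε * n) := by
    intro n k
    apply Real.exp_le_exp.mpr
    have := h n k
    have h2 : 0 ≤ ε * k := by positivity
    linarith
  have hbdd : ∀ n, BddAbove (range (τ n)) := by
    intro n
    exact ⟨_, by rintro _ ⟨k, rfl⟩; exact hb n k⟩
  refine ⟨fun n => ⨆ k, τ n k, fun n => ?_, fun n => ciSup_le (hb n), fun n => ?_⟩
  · refine le_trans (le_of_eq ?_) (le_ciSup (hbdd n) 0)
    simp only [hτ]
    congr 1
    simp
  · refine ciSup_le fun k => ?_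
    have h1 := le_ciSup (hbdd n) (k + 1)
    have h2 := mul_le_mul_of_nonneg_left h1
      (mul_pos (Real.exp_pos (-(3 * ε))) (Real.exp_pos (S (n + 1) - S n))).le
    refine le_trans (le_of_eq ?_) h2
    simp only [hτ]
    rw [← Real.exp_add, ← Real.exp_add]
    have e : n + 1 + k = n + (k + 1) := by ring
    rw [e]
    congr 1; push_cast; ring

/-- weights for the expanding directions -/
def betaSeq (S : ℕ → ℝ) (ε : ℝ) : ℕ → ℝ
  | 0 => 1
  | n + 1 => max (betaSeq S ε n / (Real.exp (-(3 * ε)) * Real.exp (S (n + 1) - S n)))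
      (Real.exp (-(4 * ε * ((n : ℝ) + 1))))

lemma weights_beta (S : ℕ → ℝ) (ε R : ℝ)
    (h : ∀ m k : ℕ, 6 * ε * k - ε * m - R ≤ S (m + k) - S m) :
    ∃ β : ℕ → ℝ, β 0 = 1 ∧ (∀ n : ℕ, Real.exp (-(4 * ε * n)) ≤ β n) ∧ (∀ n : ℕ, β n ≤ Real.exp (R - 3 * ε * n)) ∧
      ∀ n, β n ≤ Real.exp (-(3 * ε)) * Real.exp (S (n + 1) - S n) * β (n + 1) := by
  refine ⟨betaSeq S ε, rfl, fun n => ?_, fun n => ?_, fun n => ?_⟩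
  · cases n with
    | zero => simp [betaSeq]
    | succ n => rw [betaSeq]; push_cast; exact le_max_right _ _
  · have key : ∀ n, ∃ k l : ℕ, k + l = n ∧ betaSeq S ε n = Real.exp (-(S n - S k) + 3 * ε * l - 4 * ε * k) := by
      intro n
      induction n with
      | zero => exact ⟨0, 0, rfl, by simp [betaSeq]⟩
      | succ n ih =>
        obtain ⟨k, l, hkl, e⟩ := ih
        rw [betaSeq]
        rcases max_choice (betaSeq S ε n / (Real.exp (-(3 * ε)) * Real.exp (S (n + 1) - S n)))
          (Real.exp (-(4 * ε * ((n : ℝ) + 1)))) with h1 | h1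
        · refine ⟨k, l + 1, by omega, ?_⟩
          rw [h1, e, ← Real.exp_add, ← Real.exp_sub]
          congr 1; push_cast; ring
        · refine ⟨n + 1, 0, rfl, ?_⟩
          rw [h1]; congr 1; push_cast; ring
    obtain ⟨k, l, rfl, e⟩ := key n
    rw [e]
    apply Real.exp_le_exp.mpr
    have := h k l
    push_cast
    linarith
  · have h1 : betaSeq S ε n / (Real.exp (-(3 * ε)) * Real.exp (S (n + 1) - S n)) ≤ betaSeq S ε (n + 1) := by
      rw [betaSeq]; exact le_max_left _ _
    rw [div_le_iff₀ (by positivity)] at h1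
    linarith

end

section

lemma solve_curve {E : Type*} [NormedAddCommGroup E] [NormedSpace ℝ E] [CompleteSpace E]
    (T : E → E) (T' : E → E →L[ℝ] E) (c ρ K : ℝ) (hc0 : 0 ≤ c) (hc : c < 1) (hρ : 0 < ρ) (hK : 0 ≤ K)
    (hT0 : T 0 = 0)
    (h1 : ∀ x ∈ Metric.closedBall (0:E) ρ, ∀ y ∈ Metric.closedBall (0:E) ρ, ‖T x - T y‖ ≤ c * ‖x - y‖)
    (h2 : ∀ x y, ‖T x - T y - T' y (x - y)‖ ≤ K * ‖x - y‖ ^ 2)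
    (h3 : ∀ x ∈ Metric.closedBall (0:E) ρ, ‖T' x‖ ≤ c)
    (h4 : ∀ x y, ‖T' x - T' y‖ ≤ K * ‖x - y‖)
    (e0 : E) (he0 : ‖e0‖ ≤ 1) :
    ∃ y y' : ℝ → E, ∀ t, |t| ≤ (1 - c) * ρ → (y t = T (y t) + t • e0 ∧ ‖y t‖ ≤ |t| / (1 - c) ∧
      y' t = T' (y t) (y' t) + e0 ∧ ‖y' t‖ ≤ 1 / (1 - c) ∧
      ∀ s, |s| ≤ (1 - c) * ρ → ‖y t - y s - (t - s) • y' s‖ ≤ K / (1 - c) ^ 3 * |t - s| ^ 2 ∧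
        ‖y' t - y' s‖ ≤ K / (1 - c) ^ 3 * |t - s|) := by
  have hc1 : 0 < 1 - c := by linarith
  have hap : ApproximatesLinearOn (fun x => x - T x) (ContinuousLinearMap.id ℝ E)
      (Metric.closedBall (0:E) ρ) ⟨c, hc0⟩ := by
    intro x hx y hy
    have e : x - T x - (y - T y) - (ContinuousLinearMap.id ℝ E) (x - y) = -(T x - T y) := by
      simp only [ContinuousLinearMap.coe_id', id_eq]; abel
    rw [e, norm_neg]
    exact h1 x hx y hy
  have hsurj := hap.surjOn_closedBall_of_nonlinearRightInverse
    (⟨id, 1, by simp, by simp⟩ : (ContinuousLinearMap.id ℝ E).NonlinearRightInverse) hρ.le subset_rfl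
  have hex : ∀ t : ℝ, ∃ y : E, |t| ≤ (1 - c) * ρ → (y ∈ Metric.closedBall (0:E) ρ ∧ y = T y + t • e0) := by
    intro t
    by_cases ht : |t| ≤ (1 - c) * ρ
    · have : t • e0 ∈ Metric.closedBall ((fun x => x - T x) (0:E)) ((((1:ℝ≥0):ℝ)⁻¹ - (⟨c, hc0⟩ : ℝ≥0)) * ρ) := by
        rw [mem_closedBall_iff_norm]
        simp only [hT0, sub_zero, NNReal.coe_one, inv_one, NNReal.coe_mk]
        rw [norm_smul, Real.norm_eq_abs]
        refine le_trans ?_ ht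
        exact mul_le_of_le_one_right (abs_nonneg _) he0
      obtain ⟨y, hy, hy2⟩ := hsurj this
      refine ⟨y, fun _ => ⟨hy, ?_⟩⟩
      simp only at hy2
      rw [← hy2]; abel
    · exact ⟨0, fun h => absurd h ht⟩
  choose y hy using hex
  have hex' : ∀ t : ℝ, ∃ w : E, |t| ≤ (1 - c) * ρ → w = T' (y t) w + e0 := by
    intro t
    by_cases ht : |t| ≤ (1 - c) * ρ
    · have hn : ‖T' (y t)‖ < 1 := (h3 _ (hy t ht).1).trans_lt hc
      set U := Units.oneSub (T' (y t)) hn with hU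
      have hUv : ((U : E →L[ℝ] E) * (↑U⁻¹ : E →L[ℝ] E)) e0 = e0 := by
        rw [Units.mul_inv]; rfl
      refine ⟨(↑U⁻¹ : E →L[ℝ] E) e0, fun _ => ?_⟩
      have hval : (U : E →L[ℝ] E) = 1 - T' (y t) := rfl
      rw [hval, ContinuousLinearMap.mul_apply] at hUv
      rw [ContinuousLinearMap.sub_apply, ContinuousLinearMap.one_apply] at hUv
      exact sub_eq_iff_eq_add'.mp hUv
    · exact ⟨0, fun h => absurd h ht⟩
  choose y' hy' using hex'
  have hlip : ∀ t, |t| ≤ (1 - c) * ρ → ∀ s, |s| ≤ (1 - c) * ρ → ‖y t - y s‖ ≤ |t - s| / (1 - c) := by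
    intro t ht s hs
    rw [le_div_iff₀ hc1]
    have e : y t - y s = (T (y t) - T (y s)) + (t - s) • e0 := by
      conv_lhs => rw [(hy t ht).2, (hy s hs).2]
      rw [sub_smul]; abel
    have n1 : ‖y t - y s‖ ≤ c * ‖y t - y s‖ + |t - s| := by
      conv_lhs => rw [e]
      refine (norm_add_le _ _).trans (add_le_add (h1 _ (hy t ht).1 _ (hy s hs).1) ?_)
      rw [norm_smul, Real.norm_eq_abs]
      exact mul_le_of_le_one_right (abs_nonneg _) he0
    linarith
  have hz : ∀ t, |t| ≤ (1 - c) * ρ → ‖y t‖ ≤ |t| / (1 - c) := by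
    intro t ht
    rw [le_div_iff₀ hc1]
    have n1 : ‖y t‖ ≤ c * ‖y t‖ + |t| := by
      conv_lhs => rw [(hy t ht).2]
      refine (norm_add_le _ _).trans (add_le_add ?_ ?_)
      · have := h1 _ (hy t ht).1 0 (by simp [hρ.le])
        rwa [hT0, sub_zero, sub_zero] at this
      · rw [norm_smul, Real.norm_eq_abs]
        exact mul_le_of_le_one_right (abs_nonneg _) he0
    linarith
  have hy'n : ∀ t, |t| ≤ (1 - c) * ρ → ‖y' t‖ ≤ 1 / (1 - c) := by
    intro t ht
    rw [le_div_iff₀ hc1]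
    have n1 : ‖y' t‖ ≤ c * ‖y' t‖ + 1 := by
      conv_lhs => rw [hy' t ht]
      refine (norm_add_le _ _).trans (add_le_add ?_ he0)
      exact (T' (y t)).le_of_opNorm_le (h3 _ (hy t ht).1) _
    linarith
  refine ⟨y, y', fun t ht => ⟨(hy t ht).2, hz t ht, hy' t ht, hy'n t ht, fun s hs => ⟨?_, ?_⟩⟩⟩
  · set w := y t - y s - (t - s) • y' s with hw
    have e : w = (T (y t) - T (y s) - T' (y s) (y t - y s)) + T' (y s) w := by
      have a1 : w = (T (y t) + t • e0) - (T (y s) + s • e0) - (t - s) • (T' (y s) (y' s) + e0) := by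
        rw [← (hy t ht).2, ← (hy s hs).2, ← hy' s hs]
      conv_rhs => rw [hw]
      simp only [map_sub, map_smul]
      rw [a1, smul_add, sub_smul t s e0]; abel
    have n1 : ‖w‖ ≤ K * ‖y t - y s‖ ^ 2 + c * ‖w‖ := by
      conv_lhs => rw [e]
      exact (norm_add_le _ _).trans (add_le_add (h2 _ _) ((T' (y s)).le_of_opNorm_le (h3 _ (hy s hs).1) _))
    have n2 : K * ‖y t - y s‖ ^ 2 ≤ K * (|t - s| / (1 - c)) ^ 2 := by
      gcongr; exact hlip t ht s hs
    have e3 : K / (1 - c) ^ 3 * |t - s| ^ 2 = K * (|t - s| / (1 - c)) ^ 2 / (1 - c) := by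
      field_simp
    rw [e3, le_div_iff₀ hc1]
    linarith
  · set w := y' t - y' s with hw
    have e : w = T' (y t) w + (T' (y t) - T' (y s)) (y' s) := by
      have a1 : w = (T' (y t) (y' t) + e0) - (T' (y s) (y' s) + e0) := by
        rw [← hy' t ht, ← hy' s hs]
      rw [ContinuousLinearMap.sub_apply]
      conv_rhs => rw [hw, map_sub]
      rw [a1]; abel
    have n1 : ‖w‖ ≤ c * ‖w‖ + K * ‖y t - y s‖ * ‖y' s‖ := by
      conv_lhs => rw [e]
      exact (norm_add_le _ _).trans (add_le_add ((T' (y t)).le_of_opNorm_le (h3 _ (hy t ht).1) _)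
        (ContinuousLinearMap.le_of_opNorm_le _ (h4 _ _) _))
    have n2 : K * ‖y t - y s‖ * ‖y' s‖ ≤ K * (|t - s| / (1 - c)) * (1 / (1 - c)) := by
      gcongr
      · exact hlip t ht s hs
      · exact hy'n s hs
    have e3 : K / (1 - c) ^ 3 * |t - s| = K * (|t - s| / (1 - c)) * (1 / (1 - c)) / (1 - c) := by
      field_simp
    rw [e3, le_div_iff₀ hc1]
    linarith

open BoundedContinuousFunction

lemma solve_seq {ι : Type} [TopologicalSpace ι] [DiscreteTopology ι] (θ K : ℝ) (hθ0 : 0 ≤ θ) (hθ : θ < 1)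
    (hK : 0 < K) (T : ι → (ι →ᵇ ℝ) → ℝ) (T' : ι → (ι →ᵇ ℝ) → (ι →ᵇ ℝ) →L[ℝ] ℝ)
    (hT0 : ∀ i, T i 0 = 0) (hT'0 : ∀ i, ‖T' i 0‖ ≤ θ)
    (h2 : ∀ i x y, |T i x - T i y - T' i y (x - y)| ≤ K * ‖x - y‖ ^ 2)
    (h4 : ∀ i x y, ‖T' i x - T' i y‖ ≤ K * ‖x - y‖)
    (e0 : ι →ᵇ ℝ) (he0 : ‖e0‖ ≤ 1) :
    ∃ y y' : ℝ → (ι →ᵇ ℝ), ∀ t, |t| ≤ (1 - θ) ^ 2 / (12 * K) → ((∀ i, y t i = T i (y t) + t * e0 i) ∧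
      ‖y t‖ ≤ 2 * |t| / (1 - θ) ∧ (∀ i, y' t i = T' i (y t) (y' t) + e0 i) ∧ ‖y' t‖ ≤ 2 / (1 - θ) ∧
      ∀ s, |s| ≤ (1 - θ) ^ 2 / (12 * K) → ‖y t - y s - (t - s) • y' s‖ ≤ 8 * K / (1 - θ) ^ 3 * |t - s| ^ 2 ∧
        ‖y' t - y' s‖ ≤ 8 * K / (1 - θ) ^ 3 * |t - s|) := by
  have hθ1 : 0 < 1 - θ := by linarith
  have hT'n : ∀ i y, ‖T' i y‖ ≤ θ + K * ‖y‖ := by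
    intro i y
    have := h4 i y 0
    rw [sub_zero] at this
    refine ContinuousLinearMap.opNorm_le_bound _ (by positivity) fun h => ?_
    have a1 := (T' i 0).le_of_opNorm_le (hT'0 i) h
    have a2 := (T' i y - T' i 0).le_of_opNorm_le this h
    rw [ContinuousLinearMap.sub_apply] at a2
    have a3 := norm_add_le (T' i 0 h) (T' i y h - T' i 0 h)
    rw [add_sub_cancel] at a3
    linarith
  have hTn : ∀ i y, |T i y| ≤ θ * ‖y‖ + K * ‖y‖ ^ 2 := by
    intro i y
    have h := h2 i y 0
    rw [hT0, sub_zero, sub_zero] at h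
    have h' := (T' i 0).le_of_opNorm_le (hT'0 i) y
    rw [Real.norm_eq_abs] at h'
    calc |T i y| = |(T' i 0 y) + (T i y - T' i 0 y)| := by rw [add_sub_cancel]
      _ ≤ _ := (abs_add_le _ _).trans (add_le_add h' h)
  set TT : (ι →ᵇ ℝ) → (ι →ᵇ ℝ) := fun y =>
    ofNormedAddCommGroupDiscrete (fun i => T i y) (θ * ‖y‖ + K * ‖y‖ ^ 2) (fun i => hTn i y) with hTT
  have hTTa : ∀ y i, TT y i = T i y := fun y i => rfl
  set TL : (ι →ᵇ ℝ) → (ι →ᵇ ℝ) →L[ℝ] (ι →ᵇ ℝ) := fun y =>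
    LinearMap.mkContinuous
      { toFun := fun h => ofNormedAddCommGroupDiscrete (fun i => T' i y h) ((θ + K * ‖y‖) * ‖h‖)
          (fun i => (T' i y).le_of_opNorm_le (hT'n i y) h)
        map_add' := by intro a b; ext i; simp
        map_smul' := by intro a b; ext i; simp } (θ + K * ‖y‖)
      (by
        intro h
        refine (norm_le (by positivity)).mpr fun i => ?_
        exact (T' i y).le_of_opNorm_le (hT'n i y) h) with hTL
  have hTLa : ∀ y h i, TL y h i = T' i y h := fun y h i => rfl
  have hTLn : ∀ y, ‖TL y‖ ≤ θ + K * ‖y‖ := by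
    intro y
    exact LinearMap.mkContinuous_norm_le _ (by positivity) _
  set ρ := (1 - θ) / (6 * K) with hρ
  have hρ0 : 0 < ρ := by positivity
  have hKρ : K * ρ = (1 - θ) / 6 := by rw [hρ]; field_simp
  have e1 : (1 - (1 + θ) / 2) * ρ = (1 - θ) ^ 2 / (12 * K) := by rw [hρ]; field_simp; ring
  have e2 : 1 - (1 + θ) / 2 = (1 - θ) / 2 := by ring
  have B2 : ∀ x y, ‖TT x - TT y - TL y (x - y)‖ ≤ K * ‖x - y‖ ^ 2 := by
    intro x y
    exact (norm_le (by positivity)).mpr fun i => h2 i x y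
  have B4 : ∀ x y, ‖TL x - TL y‖ ≤ K * ‖x - y‖ := by
    intro x y
    refine ContinuousLinearMap.opNorm_le_bound _ (by positivity) fun h => ?_
    refine (norm_le (by positivity)).mpr fun i => ?_
    exact (T' i x - T' i y).le_of_opNorm_le (h4 i x y) h
  obtain ⟨y, y', H⟩ := solve_curve TT TL ((1 + θ) / 2) ρ K (by linarith) (by linarith) hρ0 hK.le
    (by ext i; exact hT0 i)
    (by
      intro x hx y hy
      rw [mem_closedBall_zero_iff] at hx hy
      have a1 := B2 x y
      have a2 := (TL y).le_of_opNorm_le (hTLn y) (x - y)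
      have a3 : ‖TT x - TT y‖ ≤ ‖TL y (x - y)‖ + ‖TT x - TT y - TL y (x - y)‖ := by
        calc ‖TT x - TT y‖ = ‖TL y (x - y) + (TT x - TT y - TL y (x - y))‖ := by rw [add_sub_cancel]
          _ ≤ _ := norm_add_le _ _
      have a4 : ‖x - y‖ ≤ 2 * ρ := (norm_sub_le _ _).trans (by linarith)
      have a5 : K * ‖x - y‖ ≤ K * (2 * ρ) := mul_le_mul_of_nonneg_left a4 hK.le
      have a6 : K * ‖y‖ ≤ K * ρ := mul_le_mul_of_nonneg_left hy hK.le
      have a7 : θ + K * ‖y‖ + K * ‖x - y‖ ≤ (1 + θ) / 2 := by linarith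
      have := mul_le_mul_of_nonneg_right a7 (norm_nonneg (x - y))
      nlinarith)
    B2
    (by
      intro x hx
      rw [mem_closedBall_zero_iff] at hx
      have a6 : K * ‖x‖ ≤ K * ρ := mul_le_mul_of_nonneg_left hx hK.le
      have := hTLn x
      linarith)
    B4 e0 he0
  rw [e1, e2] at H
  refine ⟨y, y', fun t ht => ?_⟩
  obtain ⟨A1, A2, A3, A4, A5⟩ := H t ht
  have e3 : K / ((1 - θ) / 2) ^ 3 = 8 * K / (1 - θ) ^ 3 := by field_simp; norm_num
  rw [e3] at A5
  refine ⟨fun i => ?_, A2.trans (le_of_eq (by field_simp)), fun i => ?_, A4.trans (le_of_eq (by field_simp)), A5⟩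
  · have := DFunLike.congr_fun A1 i
    rw [this]; rfl
  · have := DFunLike.congr_fun A3 i
    rw [this]; rfl

end

section

lemma inner_v2 (v w : V2) : inner ℝ v w = v 0 * w 0 + v 1 * w 1 := by
  rw [PiLp.inner_apply, Fin.sum_univ_two]
  simp [mul_comm]

/-- rotation by a right angle -/
def rot (v : V2) : V2 := !₂[-(v 1), v 0]

@[simp] lemma rot_0 (v : V2) : rot v 0 = -(v 1) := rfl
@[simp] lemma rot_1 (v : V2) : rot v 1 = v 0 := rfl

lemma rot_norm (v : V2) : ‖rot v‖ = ‖v‖ := by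
  have h1 := v2_norm_sq v
  have h2 := v2_norm_sq (rot v)
  rw [rot_0, rot_1] at h2
  have : ‖rot v‖ ^ 2 = ‖v‖ ^ 2 := by rw [h1, h2]; ring
  exact (sq_eq_sq₀ (norm_nonneg _) (norm_nonneg _)).mp this

lemma rot_inner (v : V2) : inner ℝ v (rot v) = 0 := by
  rw [inner_v2, rot_0, rot_1]; ring

lemma unit_decomp (u v : V2) (hu : ‖u‖ = 1) : v = (inner ℝ u v) • u + (inner ℝ (rot u) v) • rot u := by
  have h1 := v2_norm_sq u
  rw [hu] at h1
  ext i
  fin_cases i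
  · simp [inner_v2]
    linear_combination (v 0) * h1
  · simp [inner_v2]
    linear_combination (v 1) * h1

lemma det_rot (L : V2 →L[ℝ] V2) (u : V2) (hu : ‖u‖ = 1) :
    inner ℝ (rot (L u)) (L (rot u)) = LinearMap.det (L : V2 →ₗ[ℝ] V2) := by
  have h1 := v2_norm_sq u
  rw [hu] at h1
  rw [det_formula]
  have e1 : L u = (u 0) • L (ev2 0) + (u 1) • L (ev2 1) := by
    conv_lhs => rw [v2_decomp u]
    simp
  have e2 : L (rot u) = (-(u 1)) • L (ev2 0) + (u 0) • L (ev2 1) := by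
    conv_lhs => rw [v2_decomp (rot u)]
    simp
  rw [e1, e2, inner_v2, rot_0, rot_1]
  simp
  linear_combination (-(L (ev2 0) 0 * L (ev2 1) 1 - L (ev2 1) 0 * L (ev2 0) 1)) * h1

/-- the data along a regular backward orbit -/
structure UData (M ε R : ℝ) (g : TorusMap 2) (p u : ℕ → V2) (S : ℕ → ℝ) : Prop where
  nice : Nice M g
  det : ∀ x, 1 ≤ |g.detD x|
  unit : ∀ n, ‖u n‖ = 1
  map : ∀ n, fderiv ℝ g.F (p (n + 1)) (u (n + 1)) = Real.exp (-(S (n + 1) - S n)) • u n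
  good : ∀ m k : ℕ, 6 * ε * k - ε * m - R ≤ S (m + k) - S m

/-- the off-diagonal coefficient -/
def bco (g : TorusMap 2) (p u : ℕ → V2) (n : ℕ) : ℝ :=
  inner ℝ (u n) (fderiv ℝ g.F (p (n + 1)) (rot (u (n + 1))))
/-- the diagonal coefficient -/
def cco (g : TorusMap 2) (p u : ℕ → V2) (n : ℕ) : ℝ :=
  inner ℝ (rot (u n)) (fderiv ℝ g.F (p (n + 1)) (rot (u (n + 1))))

lemma rot_smul (c : ℝ) (v : V2) : rot (c • v) = c • rot v := by
  ext i; fin_cases i <;> simp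

section
variable {M ε R : ℝ} {g : TorusMap 2} {p u : ℕ → V2} {S : ℕ → ℝ}

lemma UData.fbd (h : UData M ε R g p u S) (n : ℕ) (v : V2) : ‖fderiv ℝ g.F (p n) v‖ ≤ M * ‖v‖ := by
  rw [g.fderiv_eq_D]
  exact (g.D _).le_of_opNorm_le (h.nice.bd _) v

lemma UData.bco_le (h : UData M ε R g p u S) (n : ℕ) : |bco g p u n| ≤ M := by
  have h1 := abs_real_inner_le_norm (u n) (fderiv ℝ g.F (p (n + 1)) (rot (u (n + 1))))
  have h2 := h.fbd (n + 1) (rot (u (n + 1)))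
  rw [rot_norm, h.unit, mul_one] at h2
  rw [h.unit, one_mul] at h1
  exact h1.trans h2

lemma UData.cco_eq (h : UData M ε R g p u S) (n : ℕ) :
    cco g p u n = Real.exp (S (n + 1) - S n) * g.detD (proj (p (n + 1))) := by
  have h1 := det_rot (fderiv ℝ g.F (p (n + 1))) (u (n + 1)) (h.unit _)
  rw [h.map, rot_smul, real_inner_smul_left] at h1
  unfold cco TorusMap.detD
  rw [← g.fderiv_eq_D, ← h1, ← mul_assoc, ← Real.exp_add]
  simp

lemma UData.le_cco (h : UData M ε R g p u S) (n : ℕ) : Real.exp (S (n + 1) - S n) ≤ |cco g p u n| := by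
  rw [h.cco_eq, abs_mul, abs_of_pos (Real.exp_pos _)]
  exact le_mul_of_one_le_right (Real.exp_pos _).le (h.det _)

lemma UData.a_le (h : UData M ε R g p u S) (n : ℕ) : Real.exp (-(S (n + 1) - S n)) ≤ M := by
  have h2 := h.fbd (n + 1) (u (n + 1))
  rw [h.map, norm_smul, h.unit, h.unit, mul_one, mul_one, Real.norm_eq_abs, abs_of_pos (Real.exp_pos _)] at h2
  exact h2

lemma UData.map_rot (h : UData M ε R g p u S) (n : ℕ) : fderiv ℝ g.F (p (n + 1)) (rot (u (n + 1))) =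
    bco g p u n • u n + cco g p u n • rot (u n) :=
  unit_decomp (u n) _ (h.unit n)

end

end

section

open BoundedContinuousFunction

/-- nonlinear part along the orbit -/
def qq (g : TorusMap 2) (p : ℕ → V2) (n : ℕ) (z : V2) : V2 :=
  g.F (p (n + 1) + z) - g.F (p (n + 1)) - fderiv ℝ g.F (p (n + 1)) z
/-- derivative of the nonlinear part -/
def qd (g : TorusMap 2) (p : ℕ → V2) (n : ℕ) (z : V2) : V2 →L[ℝ] V2 :=
  fderiv ℝ g.F (p (n + 1) + z) - fderiv ℝ g.F (p (n + 1))

lemma qq_zero (g : TorusMap 2) (p : ℕ → V2) (n : ℕ) : qq g p n 0 = 0 := by simp [qq]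
lemma qd_zero (g : TorusMap 2) (p : ℕ → V2) (n : ℕ) : qd g p n 0 = 0 := by simp [qd]

lemma qq_approx {M : ℝ} {g : TorusMap 2} (h : Nice M g) (p : ℕ → V2) (n : ℕ) (x y : V2) :
    ‖qq g p n x - qq g p n y - qd g p n y (x - y)‖ ≤ M * ‖x - y‖ ^ 2 := by
  have h1 := h.approx (p (n + 1) + y) ‖x - y‖ (p (n + 1) + x) (p (n + 1) + y) (by simp) (by simp)
  have e : qq g p n x - qq g p n y - qd g p n y (x - y) = g.F (p (n + 1) + x) - g.F (p (n + 1) + y) -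
      fderiv ℝ g.F (p (n + 1) + y) (p (n + 1) + x - (p (n + 1) + y)) := by
    rw [add_sub_add_left_eq_sub]
    simp only [qq, qd, ContinuousLinearMap.sub_apply, map_sub]
    abel
  rw [e]
  refine h1.trans (le_of_eq ?_)
  rw [add_sub_add_left_eq_sub]; ring

lemma qd_lip {M : ℝ} {g : TorusMap 2} (h : Nice M g) (p : ℕ → V2) (n : ℕ) (x y : V2) :
    ‖qd g p n x - qd g p n y‖ ≤ M * ‖x - y‖ := by
  have h1 := h.lip (p (n + 1) + x) (p (n + 1) + y)
  have e : qd g p n x - qd g p n y = fderiv ℝ g.F (p (n + 1) + x) - fderiv ℝ g.F (p (n + 1) + y) := by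
    simp only [qd]; abel
  rw [e]
  rwa [add_sub_add_left_eq_sub] at h1

/-- index set -/
abbrev Idx := ℕ × Bool

section
variable {E : Type*} [NormedAddCommGroup E] [NormedSpace ℝ E]

lemma comp_est {M : ℝ} {g : TorusMap 2} (h : Nice M g) (p : ℕ → V2) (n : ℕ) (φ : V2 →L[ℝ] ℝ) (Z : E →L[ℝ] V2)
    (A B K : ℝ) (hA : ‖φ‖ ≤ A) (hB : ‖Z‖ ≤ B) (hA0 : 0 ≤ A) (hB0 : 0 ≤ B) (hK : A * B ^ 2 * M ≤ K) (ℓ : E →L[ℝ] ℝ) (x y : E) :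
    |(ℓ x + φ (qq g p n (Z x))) - (ℓ y + φ (qq g p n (Z y))) -
      (ℓ + φ.comp ((qd g p n (Z y)).comp Z)) (x - y)| ≤ K * ‖x - y‖ ^ 2 ∧
    ‖(ℓ + φ.comp ((qd g p n (Z x)).comp Z)) - (ℓ + φ.comp ((qd g p n (Z y)).comp Z))‖ ≤ K * ‖x - y‖ := by
  have hM := h.one_le
  have hZ : ‖Z x - Z y‖ ≤ B * ‖x - y‖ := by
    rw [← map_sub]; exact Z.le_of_opNorm_le hB _
  constructor
  · have e : (ℓ x + φ (qq g p n (Z x))) - (ℓ y + φ (qq g p n (Z y))) -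
      (ℓ + φ.comp ((qd g p n (Z y)).comp Z)) (x - y) =
      φ (qq g p n (Z x) - qq g p n (Z y) - qd g p n (Z y) (Z x - Z y)) := by
      simp only [ContinuousLinearMap.add_apply, ContinuousLinearMap.comp_apply, map_sub]; ring
    rw [e, ← Real.norm_eq_abs]
    calc _ ≤ A * ‖qq g p n (Z x) - qq g p n (Z y) - qd g p n (Z y) (Z x - Z y)‖ := φ.le_of_opNorm_le hA _
      _ ≤ A * (M * ‖Z x - Z y‖ ^ 2) := by gcongr; exact qq_approx h p n _ _
      _ ≤ A * (M * (B * ‖x - y‖) ^ 2) := by gcongr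
      _ = (A * B ^ 2 * M) * ‖x - y‖ ^ 2 := by ring
      _ ≤ _ := by gcongr
  · have hK0 : 0 ≤ K := le_trans (by positivity) hK
    refine ContinuousLinearMap.opNorm_le_bound _ (by positivity) fun w => ?_
    have e : ((ℓ + φ.comp ((qd g p n (Z x)).comp Z)) - (ℓ + φ.comp ((qd g p n (Z y)).comp Z))) w =
        φ ((qd g p n (Z x) - qd g p n (Z y)) (Z w)) := by
      simp only [ContinuousLinearMap.add_apply, ContinuousLinearMap.comp_apply, map_sub,
        ContinuousLinearMap.sub_apply]; ring
    rw [e]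
    calc _ ≤ A * ‖(qd g p n (Z x) - qd g p n (Z y)) (Z w)‖ := φ.le_of_opNorm_le hA _
      _ ≤ A * ((M * ‖Z x - Z y‖) * ‖Z w‖) := by
        gcongr; exact ContinuousLinearMap.le_of_opNorm_le _ (qd_lip h p n _ _) _
      _ ≤ A * ((M * (B * ‖x - y‖)) * (B * ‖w‖)) := by gcongr; exact Z.le_of_opNorm_le hB _
      _ = (A * B ^ 2 * M) * ‖x - y‖ * ‖w‖ := by ring
      _ ≤ _ := by gcongr
end

/-- reconstruction of the displacement from the weighted coordinates -/
def Zc (u : ℕ → V2) (α γ : ℕ → ℝ) (n : ℕ) : (Idx →ᵇ ℝ) →L[ℝ] V2 :=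
  (evalCLM ℝ ((n, false) : Idx)).smulRight (α n • u n) + (evalCLM ℝ ((n, true) : Idx)).smulRight (γ n • rot (u n))

lemma Zc_apply (u : ℕ → V2) (α γ : ℕ → ℝ) (n : ℕ) (y : Idx →ᵇ ℝ) :
    Zc u α γ n y = (y (n, false) * α n) • u n + (y (n, true) * γ n) • rot (u n) := by
  simp [Zc, smul_smul]

lemma Zc_norm (u : ℕ → V2) (hu : ∀ n, ‖u n‖ = 1) (α γ : ℕ → ℝ) (hα : ∀ n, 0 ≤ α n) (hγ : ∀ n, 0 ≤ γ n) (n : ℕ) :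
    ‖Zc u α γ n‖ ≤ α n + γ n := by
  have := hα n
  have := hγ n
  refine ContinuousLinearMap.opNorm_le_bound _ (by positivity) fun y => ?_
  rw [Zc_apply]
  refine (norm_add_le _ _).trans ?_
  rw [norm_smul, norm_smul, rot_norm, hu, norm_mul, norm_mul, Real.norm_of_nonneg (hα n), Real.norm_of_nonneg (hγ n)]
  have h1 := y.norm_coe_le_norm (n, false)
  have h2 := y.norm_coe_le_norm (n, true)
  nlinarith

/-- linear part of the system -/
def lc (α γ l c b : ℕ → ℝ) : Idx → ((Idx →ᵇ ℝ) →L[ℝ] ℝ)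
  | (n, false) => (l n * α (n + 1) / α n) • evalCLM ℝ ((n + 1, false) : Idx) +
      (b n * γ (n + 1) / α n) • evalCLM ℝ ((n + 1, true) : Idx)
  | (0, true) => 0
  | (n + 1, true) => (γ n / (c n * γ (n + 1))) • evalCLM ℝ ((n, true) : Idx)

/-- functionals applied to the nonlinear part -/
def pc (u : ℕ → V2) (α γ c : ℕ → ℝ) : Idx → (V2 →L[ℝ] ℝ)
  | (n, false) => (1 / α n) • innerSL ℝ (u n)
  | (0, true) => 0
  | (n + 1, true) => (-(1 / (c n * γ (n + 1)))) • innerSL ℝ (rot (u n))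

/-- index shift -/
def sh : Idx → ℕ
  | (n, false) => n
  | (n, true) => n - 1

end

section

open BoundedContinuousFunction

lemma lc_norm (α γ l c b : ℕ → ℝ) (θ θ₁ : ℝ) (hθ : 0 ≤ θ) (hθ₁ : 0 ≤ θ₁)
    (h1 : ∀ n, |l n * α (n + 1) / α n| ≤ θ) (h2 : ∀ n, |b n * γ (n + 1) / α n| ≤ θ₁)
    (h3 : ∀ n, |γ n / (c n * γ (n + 1))| ≤ θ) (i : Idx) : ‖lc α γ l c b i‖ ≤ θ + θ₁ := by
  refine ContinuousLinearMap.opNorm_le_bound _ (by positivity) fun y => ?_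
  have hb : ∀ j : Idx, |y j| ≤ ‖y‖ := fun j => y.norm_coe_le_norm j
  have hy := norm_nonneg y
  match i with
  | (n, false) =>
    simp only [lc, ContinuousLinearMap.add_apply, ContinuousLinearMap.smul_apply, evalCLM_apply, smul_eq_mul,
      Real.norm_eq_abs]
    refine (abs_add_le _ _).trans ?_
    rw [abs_mul, abs_mul, add_mul]
    exact add_le_add (mul_le_mul (h1 n) (hb _) (abs_nonneg _) hθ) (mul_le_mul (h2 n) (hb _) (abs_nonneg _) hθ₁)
  | (0, true) => simp [lc]; positivity
  | (n + 1, true) =>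
    simp only [lc, ContinuousLinearMap.smul_apply, evalCLM_apply, smul_eq_mul, Real.norm_eq_abs]
    rw [abs_mul]
    refine (mul_le_mul (h3 n) (hb _) (abs_nonneg _) hθ).trans ?_
    nlinarith

lemma pc_norm_f (u : ℕ → V2) (hu : ∀ n, ‖u n‖ = 1) (α γ c : ℕ → ℝ) (n : ℕ) :
    ‖pc u α γ c (n, false)‖ ≤ |1 / α n| := by
  simp only [pc]
  rw [norm_smul, innerSL_apply_norm, hu, mul_one, Real.norm_eq_abs]

lemma pc_norm_t (u : ℕ → V2) (hu : ∀ n, ‖u n‖ = 1) (α γ c : ℕ → ℝ) (n : ℕ) :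
    ‖pc u α γ c (n + 1, true)‖ ≤ |1 / (c n * γ (n + 1))| := by
  simp only [pc]
  rw [norm_smul, innerSL_apply_norm, rot_norm, hu, mul_one, Real.norm_eq_abs, abs_neg]

lemma unst_curve (M ε R : ℝ) (hM : 1 ≤ M) (hε : 0 < ε) (hR : 0 ≤ R) :
    ∃ τ K2 B ϱ : ℝ, 0 < τ ∧ 0 < K2 ∧ 0 < B ∧ 0 < ϱ ∧ ∀ (g : TorusMap 2) (p u : ℕ → V2) (S : ℕ → ℝ),
    UData M ε R g p u S → ∃ (z : ℝ → ℕ → V2) (d : ℝ → V2), ∀ t, |t| ≤ τ →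
      ((∀ n, z t n = g.F (p (n + 1) + z t (n + 1)) - g.F (p (n + 1))) ∧
       (∀ n : ℕ, ‖z t n‖ ≤ B * |t| * Real.exp (-(2 * ε * n))) ∧
       inner ℝ (rot (u 0)) (z t 0) = ϱ * t ∧ inner ℝ (rot (u 0)) (d t) = ϱ ∧
       ∀ s, |s| ≤ τ → ‖z t 0 - z s 0 - (t - s) • d s‖ ≤ K2 * |t - s| ^ 2 ∧ ‖d t - d s‖ ≤ K2 * |t - s|) := by
  set θ := Real.exp (-(3 * ε)) with hθdef
  have hθ0 : 0 < θ := Real.exp_pos _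
  have hθ1 : θ < 1 := Real.exp_lt_one_iff.mpr (by linarith)
  set eR := Real.exp R with heR
  have heR1 : 1 ≤ eR := Real.one_le_exp hR
  set ϱ := (1 - θ) / (4 * M * eR) with hϱ
  have h1θ : 0 < 1 - θ := by linarith
  have hϱ0 : 0 < ϱ := by positivity
  have hMe : 1 ≤ M * eR := by nlinarith
  have hϱ1 : ϱ ≤ 1 := by
    rw [hϱ, div_le_one (by positivity)]; nlinarith
  have hϱM : M * ϱ * eR = (1 - θ) / 4 := by rw [hϱ]; field_simp
  set θ' := θ + (1 - θ) / 4 with hθ'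
  have hθ'0 : 0 ≤ θ' := by positivity
  have hθ'1 : θ' < 1 := by rw [hθ']; linarith
  have h1θ' : 0 < 1 - θ' := by linarith
  set K := 4 * M ^ 2 * eR ^ 2 / ϱ with hK
  have hK0 : 0 < K := by positivity
  refine ⟨(1 - θ') ^ 2 / (12 * K), 2 * eR * (8 * K / (1 - θ') ^ 3), 2 * eR * (2 / (1 - θ')), ϱ, by positivity,
    by positivity, by positivity, hϱ0, fun g p u S h => ?_⟩
  obtain ⟨α, hα1, hα2, hα3⟩ := weights_alpha S ε R hε h.good
  obtain ⟨β, hβ0, hβ1, hβ2, hβ3⟩ := weights_beta S ε R h.good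
  have hα0 : ∀ n, 0 < α n := fun n => (Real.exp_pos _).trans_le (hα1 n)
  have hβp : ∀ n, 0 < β n := fun n => (Real.exp_pos _).trans_le (hβ1 n)
  set γ : ℕ → ℝ := fun n => ϱ * β n with hγ
  have hγ0 : ∀ n, 0 < γ n := fun n => mul_pos hϱ0 (hβp n)
  set l : ℕ → ℝ := fun n => Real.exp (-(S (n + 1) - S n)) with hl
  set a : ℕ → ℝ := fun n => Real.exp (S (n + 1) - S n) with ha
  have hla : ∀ n, l n * a n = 1 := by intro n; simp only [hl, ha]; rw [← Real.exp_add]; simp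
  have hl0 : ∀ n, 0 < l n := fun n => Real.exp_pos _
  have ha0 : ∀ n, 0 < a n := fun n => Real.exp_pos _
  set c := cco g p u with hc
  set b := bco g p u with hb
  have hca : ∀ n, a n ≤ |c n| := h.le_cco
  have hc0 : ∀ n, c n ≠ 0 := fun n => abs_pos.mp ((ha0 n).trans_le (hca n))
  have hlM : ∀ n, l n ≤ M := h.a_le
  -- size of Z
  have hZn : ∀ n : ℕ, ‖Zc u α γ n‖ ≤ 2 * eR * Real.exp (-(2 * ε * n)) := by
    intro n
    refine (Zc_norm u h.unit α γ (fun n => (hα0 n).le) (fun n => (hγ0 n).le) n).trans ?_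
    have e1 : Real.exp (R - 2 * ε * n) = eR * Real.exp (-(2 * ε * n)) := by
      rw [heR, ← Real.exp_add]; congr 1
    have a1 := hα2 n
    have a2 : γ n ≤ Real.exp (R - 2 * ε * n) := by
      have : β n ≤ Real.exp (R - 2 * ε * n) := (hβ2 n).trans (Real.exp_le_exp.mpr (by
        have : 0 ≤ ε * n := by positivity
        linarith))
      exact (mul_le_of_le_one_left (hβp n).le hϱ1).trans this
    rw [e1] at a1 a2
    linarith
  -- linear part
  have L1 : ∀ n, |l n * α (n + 1) / α n| ≤ θ := by
    intro n
    have : 0 ≤ l n * α (n + 1) / α n := by have := hl0 n; have := hα0 n; have := hα0 (n + 1); positivity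
    rw [abs_of_nonneg this, div_le_iff₀ (hα0 n)]
    have := mul_le_mul_of_nonneg_left (hα3 n) (hl0 n).le
    refine this.trans (le_of_eq ?_)
    have e := hla n
    simp only [ha] at e
    linear_combination (θ * α n) * e
  have L2 : ∀ n, |b n * γ (n + 1) / α n| ≤ (1 - θ) / 4 := by
    intro n
    rw [abs_div, abs_mul, abs_of_pos (hγ0 _), abs_of_pos (hα0 n), div_le_iff₀ (hα0 n)]
    have h1 := h.bco_le n
    have h2 : γ (n + 1) ≤ ϱ * (eR * α n) := by
      refine mul_le_mul_of_nonneg_left ?_ hϱ0.le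
      refine (hβ2 (n + 1)).trans ?_
      have : Real.exp (R - 3 * ε * ((n + 1 : ℕ) : ℝ)) ≤ eR * Real.exp (-(3 * ε * n)) := by
        rw [heR, ← Real.exp_add]
        apply Real.exp_le_exp.mpr
        push_cast; linarith
      refine this.trans ?_
      gcongr; exact hα1 n
    calc |b n| * γ (n + 1) ≤ M * (ϱ * (eR * α n)) := mul_le_mul h1 h2 (hγ0 _).le (by linarith)
      _ = M * ϱ * eR * α n := by ring
      _ = _ := by rw [hϱM]
  have L3 : ∀ n, |γ n / (c n * γ (n + 1))| ≤ θ := by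
    intro n
    rw [abs_div, abs_of_pos (hγ0 n), abs_mul (c n), abs_of_pos (hγ0 (n+1)),
      div_le_iff₀ (mul_pos (abs_pos.mpr (hc0 n)) (hγ0 _))]
    have h1 := hβ3 n
    have h2 : θ * a n * β (n + 1) ≤ θ * |c n| * β (n + 1) := by
      have := hβp (n + 1); have := hca n; gcongr
    have h3 : β n ≤ θ * |c n| * β (n + 1) := h1.trans h2
    have h4 := mul_le_mul_of_nonneg_left h3 hϱ0.le
    simp only [hγ]
    linarith
  have hln : ∀ i, ‖lc α γ l c b i‖ ≤ θ' := lc_norm α γ l c b θ _ hθ0.le (by positivity) L1 L2 L3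
  -- nonlinear part
  have hprod : ∀ i, ∃ A : ℝ, ‖pc u α γ c i‖ ≤ A ∧ 0 ≤ A ∧
      A * (2 * eR * Real.exp (-(2 * ε * ((sh i + 1 : ℕ) : ℝ)))) ^ 2 * M ≤ K := by
    intro i
    have esq : ∀ n : ℕ, (2 * eR * Real.exp (-(2 * ε * ((n + 1 : ℕ) : ℝ)))) ^ 2 =
        4 * eR ^ 2 * Real.exp (-(4 * ε * ((n : ℝ) + 1))) := by
      intro n
      rw [mul_pow, ← Real.exp_nat_mul]
      have : ((2:ℕ):ℝ) * -(2 * ε * ((n + 1 : ℕ) : ℝ)) = -(4 * ε * ((n : ℝ) + 1)) := by push_cast; ring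
      rw [this]; ring
    match i with
    | (n, false) =>
      refine ⟨_, pc_norm_f u h.unit α γ c n, abs_nonneg _, ?_⟩
      simp only [sh]
      rw [esq]
      have h1 : |1 / α n| ≤ Real.exp (3 * ε * n) := by
        rw [abs_of_pos (by have := hα0 n; positivity), div_le_iff₀ (hα0 n)]
        have := mul_le_mul_of_nonneg_left (hα1 n) (Real.exp_pos (3 * ε * n)).le
        rw [← Real.exp_add, add_neg_cancel, Real.exp_zero] at this
        exact this
      have h2 : Real.exp (3 * ε * n) * Real.exp (-(4 * ε * ((n : ℝ) + 1))) ≤ 1 := by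
        rw [← Real.exp_add]
        apply Real.exp_le_one_iff.mpr
        have : 0 ≤ ε * n := by positivity
        linarith
      calc |1 / α n| * (4 * eR ^ 2 * Real.exp (-(4 * ε * ((n : ℝ) + 1)))) * M
          ≤ Real.exp (3 * ε * n) * (4 * eR ^ 2 * Real.exp (-(4 * ε * ((n : ℝ) + 1)))) * M := by gcongr
        _ = 4 * M * eR ^ 2 * (Real.exp (3 * ε * n) * Real.exp (-(4 * ε * ((n : ℝ) + 1)))) := by ring
        _ ≤ 4 * M * eR ^ 2 * 1 := by gcongr
        _ ≤ K := by
          rw [hK, le_div_iff₀ hϱ0]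
          have : 4 * M * eR ^ 2 * 1 * ϱ ≤ 4 * M * eR ^ 2 * 1 * 1 := by gcongr
          refine this.trans ?_
          have : 0 < eR ^ 2 := by positivity
          nlinarith [mul_le_mul_of_nonneg_right hM (by positivity : 0 ≤ M * eR ^ 2)]
    | (0, true) => exact ⟨0, by simp [pc], le_rfl, by simp; exact hK0.le⟩
    | (n + 1, true) =>
      refine ⟨_, pc_norm_t u h.unit α γ c n, abs_nonneg _, ?_⟩
      simp only [sh, Nat.add_sub_cancel]
      rw [esq]
      have h1 : |1 / (c n * γ (n + 1))| ≤ M * (1 / ϱ) * Real.exp (4 * ε * ((n : ℝ) + 1)) := by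
        rw [abs_div, abs_one, abs_mul (c n), abs_of_pos (hγ0 _),
          div_le_iff₀ (mul_pos (abs_pos.mpr (hc0 n)) (hγ0 _))]
        have k1 : 1 ≤ M * |c n| := by
          calc 1 = l n * a n := (hla n).symm
            _ ≤ M * |c n| := mul_le_mul (hlM n) (hca n) (ha0 n).le (by linarith)
        have k2 : 1 ≤ Real.exp (4 * ε * ((n : ℝ) + 1)) * β (n + 1) := by
          have := mul_le_mul_of_nonneg_left (hβ1 (n + 1)) (Real.exp_pos (4 * ε * ((n : ℝ) + 1))).le
          push_cast at this
          rw [← Real.exp_add, add_neg_cancel, Real.exp_zero] at this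
          exact this
        have e : M * (1 / ϱ) * Real.exp (4 * ε * ((n : ℝ) + 1)) * (|c n| * γ (n + 1)) =
            (M * |c n|) * (Real.exp (4 * ε * ((n : ℝ) + 1)) * β (n + 1)) := by
          simp only [hγ]; field_simp
        rw [e]
        nlinarith
      have h2 : Real.exp (4 * ε * ((n : ℝ) + 1)) * Real.exp (-(4 * ε * ((n : ℝ) + 1))) = 1 := by
        rw [← Real.exp_add]; simp
      calc |1 / (c n * γ (n + 1))| * (4 * eR ^ 2 * Real.exp (-(4 * ε * ((n : ℝ) + 1)))) * M
          ≤ (M * (1 / ϱ) * Real.exp (4 * ε * ((n : ℝ) + 1))) * (4 * eR ^ 2 * Real.exp (-(4 * ε * ((n : ℝ) + 1)))) * M := by gcongr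
        _ = 4 * M ^ 2 * eR ^ 2 * (1 / ϱ) * (Real.exp (4 * ε * ((n : ℝ) + 1)) * Real.exp (-(4 * ε * ((n : ℝ) + 1)))) := by ring
        _ = K := by rw [h2, hK]; ring
        _ ≤ K := le_rfl
  set Z : Idx → (Idx →ᵇ ℝ) →L[ℝ] V2 := fun i => Zc u α γ (sh i + 1) with hZ
  set T : Idx → (Idx →ᵇ ℝ) → ℝ := fun i y => lc α γ l c b i y + pc u α γ c i (qq g p (sh i) (Z i y)) with hT
  set T' : Idx → (Idx →ᵇ ℝ) → (Idx →ᵇ ℝ) →L[ℝ] ℝ := fun i y =>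
    lc α γ l c b i + (pc u α γ c i).comp ((qd g p (sh i) (Z i y)).comp (Z i)) with hT'
  have hest : ∀ i x y, |T i x - T i y - T' i y (x - y)| ≤ K * ‖x - y‖ ^ 2 ∧
      ‖T' i x - T' i y‖ ≤ K * ‖x - y‖ := by
    intro i x y
    obtain ⟨A, hA1, hA0, hA2⟩ := hprod i
    exact comp_est h.nice p (sh i) (pc u α γ c i) (Z i) A _ K hA1 (hZn (sh i + 1)) hA0 (by positivity) hA2
      (lc α γ l c b i) x y
  set e0 : Idx →ᵇ ℝ := ofNormedAddCommGroupDiscrete (fun i : Idx => if i = (0, true) then (1:ℝ) else 0) 1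
    (by intro i; split_ifs <;> simp) with he0
  have he0a : ∀ i, e0 i = if i = (0, true) then (1:ℝ) else 0 := fun i => rfl
  have he0n : ‖e0‖ ≤ 1 := by
    refine (norm_le zero_le_one).mpr fun i => ?_
    rw [he0a]; split_ifs <;> simp
  obtain ⟨y, y', H⟩ := solve_seq θ' K hθ'0 hθ'1 hK0 T T' (by intro i; simp [hT, qq_zero])
    (by intro i; simp only [hT', map_zero, qd_zero, ContinuousLinearMap.zero_comp, ContinuousLinearMap.comp_zero, add_zero]; exact hln i)
    (fun i x y => (hest i x y).1) (fun i x y => (hest i x y).2) e0 he0n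
  have inn1 : inner ℝ (rot (u 0)) (u 0) = (0:ℝ) := by rw [real_inner_comm]; exact rot_inner _
  have inn2 : inner ℝ (rot (u 0)) (rot (u 0)) = (1:ℝ) := by
    rw [real_inner_self_eq_norm_sq, rot_norm, h.unit]; norm_num
  have hγ00 : γ 0 = ϱ := by simp only [hγ]; rw [hβ0, mul_one]
  have hZ0 : ∀ w : Idx →ᵇ ℝ, ‖Zc u α γ 0 w‖ ≤ 2 * eR * ‖w‖ := by
    intro w
    have := hZn 0
    simp only [Nat.cast_zero, mul_zero, neg_zero, Real.exp_zero, mul_one] at this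
    exact (Zc u α γ 0).le_of_opNorm_le this w
  refine ⟨fun t n => Zc u α γ n (y t), fun t => Zc u α γ 0 (y' t), fun t ht => ?_⟩
  obtain ⟨A1, A2, A3, A4, A5⟩ := H t ht
  refine ⟨fun n => ?_, fun n => ?_, ?_, ?_, fun s hs => ⟨?_, ?_⟩⟩
  · set q := qq g p n (Zc u α γ (n + 1) (y t)) with hq
    have e1 : g.F (p (n + 1) + Zc u α γ (n + 1) (y t)) - g.F (p (n + 1)) =
        fderiv ℝ g.F (p (n + 1)) (Zc u α γ (n + 1) (y t)) + q := by
      rw [hq, qq]; abel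
    have i1 := A1 (n, false)
    have i2 := A1 (n + 1, true)
    rw [he0a, if_neg (by simp), mul_zero, add_zero] at i1 i2
    simp only [hT, hZ, lc, pc, sh, Nat.add_sub_cancel, ContinuousLinearMap.add_apply, ContinuousLinearMap.smul_apply, evalCLM_apply,
      smul_eq_mul, innerSL_apply_apply] at i1 i2
    rw [← hq] at i1 i2
    show Zc u α γ n (y t) = _
    rw [e1, Zc_apply, Zc_apply, map_add, map_smul, map_smul, h.map, h.map_rot]
    have e2 : q = (inner ℝ (u n) q) • u n + (inner ℝ (rot (u n)) q) • rot (u n) := unit_decomp _ _ (h.unit n)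
    have hαn := (hα0 n).ne'
    have hγn := (hγ0 (n + 1)).ne'
    have hcn := hc0 n
    have c1 : y t (n, false) * α n = y t (n + 1, false) * α (n + 1) * l n +
        y t (n + 1, true) * γ (n + 1) * b n + inner ℝ (u n) q := by
      rw [i1]; field_simp
    have c2 : y t (n, true) * γ n = y t (n + 1, true) * γ (n + 1) * c n + inner ℝ (rot (u n)) q := by
      rw [i2]; field_simp; ring
    conv_rhs => rw [e2]
    rw [c1, c2]
    simp only [smul_add, smul_smul, add_smul]
    abel
  · refine ((Zc u α γ n).le_of_opNorm_le (hZn n) (y t)).trans ?_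
    have : 2 * eR * (2 / (1 - θ')) * |t| * Real.exp (-(2 * ε * n)) =
      2 * eR * Real.exp (-(2 * ε * n)) * (2 * |t| / (1 - θ')) := by ring
    rw [this]
    gcongr
  · have i1 := A1 (0, true)
    rw [he0a, if_pos rfl, mul_one] at i1
    simp only [hT, lc, pc, ContinuousLinearMap.zero_apply, zero_add] at i1
    show inner ℝ (rot (u 0)) (Zc u α γ 0 (y t)) = ϱ * t
    rw [Zc_apply, inner_add_right, real_inner_smul_right, real_inner_smul_right, inn1, inn2, i1, hγ00]
    ring
  · have i1 := A3 (0, true)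
    rw [he0a, if_pos rfl] at i1
    simp only [hT', lc, pc, ContinuousLinearMap.zero_apply, ContinuousLinearMap.zero_comp, zero_add] at i1
    show inner ℝ (rot (u 0)) (Zc u α γ 0 (y' t)) = ϱ
    rw [Zc_apply, inner_add_right, real_inner_smul_right, real_inner_smul_right, inn1, inn2, i1, hγ00]
    ring
  · have e : Zc u α γ 0 (y t) - Zc u α γ 0 (y s) - (t - s) • Zc u α γ 0 (y' s) =
        Zc u α γ 0 (y t - y s - (t - s) • y' s) := by simp only [map_sub, map_smul]
    show ‖Zc u α γ 0 (y t) - Zc u α γ 0 (y s) - (t - s) • Zc u α γ 0 (y' s)‖ ≤ _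
    rw [e, mul_assoc]
    refine (hZ0 _).trans ?_
    have := (A5 s hs).1
    gcongr
  · show ‖Zc u α γ 0 (y' t) - Zc u α γ 0 (y' s)‖ ≤ _
    rw [← map_sub, mul_assoc]
    refine (hZ0 _).trans ?_
    have := (A5 s hs).2
    gcongr

end

section

lemma graph_fun (I : Set ℝ) (X Y : ℝ → ℝ) (h : ∀ t ∈ I, ∀ s ∈ I, |Y t - Y s| ≤ |X t - X s|) :
    ∃ φ : ℝ → ℝ, LipschitzOnWith 1 φ (X '' I) ∧ ∀ t ∈ I, φ (X t) = Y t := by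
  have key : ∀ t ∈ I, Y (Function.invFunOn X I (X t)) = Y t := by
    intro t ht
    have hex : ∃ a ∈ I, X a = X t := ⟨t, ht, rfl⟩
    have h1 := h _ (Function.invFunOn_mem hex) t ht
    rw [Function.invFunOn_eq hex, sub_self, abs_zero] at h1
    have := abs_nonpos_iff.mp h1
    linarith
  refine ⟨fun x => Y (Function.invFunOn X I x), ?_, key⟩
  apply LipschitzOnWith.of_dist_le_mul
  rintro _ ⟨t, ht, rfl⟩ _ ⟨s, hs, rfl⟩
  beta_reduce
  rw [key t ht, key s hs, Real.dist_eq, Real.dist_eq]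
  simpa using h t ht s hs

lemma curve_deriv (τ K2 : ℝ) (G d : ℝ → V2)
    (hq : ∀ t s, |t| ≤ τ → |s| ≤ τ → ‖G t - G s - (t - s) • d s‖ ≤ K2 * |t - s| ^ 2)
    (s : ℝ) (hs : |s| < τ) : HasDerivAt G (d s) s := by
  rw [hasDerivAt_iff_isLittleO]
  have h1 : (fun t => G t - G s - (t - s) • d s) =O[𝓝 s] fun t => (t - s) ^ 2 := by
    apply Asymptotics.IsBigO.of_bound K2
    have : ∀ᶠ t in 𝓝 s, |t| < τ := (continuous_abs.tendsto s).eventually_lt_const hs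
    filter_upwards [this] with t ht
    rw [Real.norm_eq_abs, abs_pow]
    exact hq t s ht.le hs.le
  refine h1.trans_isLittleO ?_
  have : (fun t : ℝ => (t - s) ^ 2) = fun t => (t - s) * (t - s) := by ext; ring
  rw [this]
  have h2 : (fun t : ℝ => t - s) =o[𝓝 s] (fun _ => (1:ℝ)) := by
    rw [Asymptotics.isLittleO_one_iff]
    have : Tendsto (fun t : ℝ => t - s) (𝓝 s) (𝓝 (s - s)) := by
      exact (continuous_id.sub continuous_const).tendsto s
    simpa using this
  simpa using h2.mul_isBigO (Asymptotics.isBigO_refl (fun t : ℝ => t - s) (𝓝 s))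

lemma curve_d_cont (τ K2 : ℝ) (d : ℝ → V2)
    (hq : ∀ t s, |t| ≤ τ → |s| ≤ τ → ‖d t - d s‖ ≤ K2 * |t - s|) : ContinuousOn d {t | |t| ≤ τ} := by
  have : LipschitzOnWith (Real.toNNReal K2) d {t | |t| ≤ τ} := by
    apply LipschitzOnWith.of_dist_le_mul
    intro t ht s hs
    rw [dist_eq_norm, Real.dist_eq]
    refine (hq t s ht hs).trans ?_
    gcongr
    exact Real.le_coe_toNNReal K2
  exact this.continuousOn

lemma curve_diff (τ a K2 : ℝ) (haτ : a ≤ τ) (hK : 0 ≤ K2) (ha : 0 ≤ a) (G d : ℝ → V2)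
    (hq : ∀ t s, |t| ≤ τ → |s| ≤ τ → ‖G t - G s - (t - s) • d s‖ ≤ K2 * |t - s| ^ 2)
    (hd : ∀ t s, |t| ≤ τ → |s| ≤ τ → ‖d t - d s‖ ≤ K2 * |t - s|)
    (t s : ℝ) (ht : |t| ≤ a) (hs : |s| ≤ a) :
    ‖G t - G s - (t - s) • d 0‖ ≤ 3 * K2 * a * |t - s| := by
  have h1 := hq t s (ht.trans haτ) (hs.trans haτ)
  have h2 := hd s 0 (hs.trans haτ) (by simpa using ha.trans haτ)
  rw [sub_zero] at h2
  have e : G t - G s - (t - s) • d 0 = (G t - G s - (t - s) • d s) + (t - s) • (d s - d 0) := by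
    rw [smul_sub]; abel
  rw [e]
  refine (norm_add_le _ _).trans ?_
  rw [norm_smul, Real.norm_eq_abs]
  have h3 : |t - s| ≤ 2 * a := (abs_sub t s).trans (by linarith)
  have h4 : K2 * |t - s| ^ 2 ≤ K2 * (2 * a) * |t - s| := by
    rw [pow_two, ← mul_assoc]; gcongr
  have h5 : |t - s| * ‖d s - d 0‖ ≤ |t - s| * (K2 * a) := by
    gcongr; exact h2.trans (by gcongr)
  nlinarith

lemma abs_inner_unit (u v : V2) (hu : ‖u‖ = 1) : |inner ℝ u v| ≤ ‖v‖ := by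
  have := abs_real_inner_le_norm u v
  rwa [hu, one_mul] at this

lemma big_curve (M ε R : ℝ) (hM : 1 ≤ M) (hε : 0 < ε) (hR : 0 ≤ R) :
    ∃ ℓ₀ : ℝ, 0 < ℓ₀ ∧ ∀ (g : TorusMap 2) (p u : ℕ → V2) (S : ℕ → ℝ) (ω : ℕ → T2),
      UData M ε R g p u S → (∀ n, proj (p n) = ω n) → (∀ n, g.toFun (ω (n + 1)) = ω n) →
      ∃ σ : ℝ → V2, proj (σ 0) = ω 0 ∧ IsLipGraph 1 σ 0 ∧ ℓ₀ < clen σ ∧ IsUnstMan g ω σ := by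
  obtain ⟨τ, K2, B, ϱ, hτ, hK2, hB, hϱ, H⟩ := unst_curve M ε R hM hε hR
  obtain ⟨a, ha0, haτ, haK, haB⟩ : ∃ a : ℝ, 0 < a ∧ a ≤ τ / 2 ∧ 3 * K2 * a ≤ ϱ / 2 ∧ 2 * B * a < 1 := by
    refine ⟨min (τ / 2) (min (ϱ / (6 * K2)) (1 / (4 * B))), by positivity, min_le_left _ _, ?_, ?_⟩
    · have : min (τ / 2) (min (ϱ / (6 * K2)) (1 / (4 * B))) ≤ ϱ / (6 * K2) :=
        (min_le_right _ _).trans (min_le_left _ _)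
      rw [le_div_iff₀ (by positivity)] at this
      linarith
    · have : min (τ / 2) (min (ϱ / (6 * K2)) (1 / (4 * B))) ≤ 1 / (4 * B) :=
        (min_le_right _ _).trans (min_le_right _ _)
      rw [le_div_iff₀ (by positivity)] at this
      linarith
  refine ⟨ϱ * a * Real.cos 1, by have := Real.cos_one_pos; positivity, ?_⟩
  intro g p u S ω hU hp hω
  obtain ⟨z, d, Hz⟩ := H g p u S hU
  have haτ' : a < τ := by linarith
  set G : ℝ → V2 := fun t => z t 0 with hG
  have hru : ‖rot (u 0)‖ = 1 := by rw [rot_norm, hU.unit]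
  have hq : ∀ t s, |t| ≤ τ → |s| ≤ τ → ‖G t - G s - (t - s) • d s‖ ≤ K2 * |t - s| ^ 2 :=
    fun t s ht hs => ((Hz t ht).2.2.2.2 s hs).1
  have hd : ∀ t s, |t| ≤ τ → |s| ≤ τ → ‖d t - d s‖ ≤ K2 * |t - s| :=
    fun t s ht hs => ((Hz t ht).2.2.2.2 s hs).2
  have hdϱ : ∀ t, |t| ≤ τ → ϱ ≤ ‖d t‖ := by
    intro t ht
    have := abs_inner_unit _ (d t) hru
    rw [(Hz t ht).2.2.2.1, abs_of_pos hϱ] at this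
    exact this
  have hsin : ∀ t : ℝ, |a * Real.sin t| ≤ a := by
    intro t
    rw [abs_mul, abs_of_pos ha0]
    have := Real.abs_sin_le_one t
    nlinarith
  have hsinτ : ∀ t : ℝ, |a * Real.sin t| ≤ τ := fun t => (hsin t).trans haτ'.le
  have hz0 : G 0 = 0 := by
    have := (Hz 0 (by simpa using hτ.le)).2.1 0
    simpa using this
  have hσd : ∀ t, HasDerivAt (fun t => p 0 + G (a * Real.sin t)) ((a * Real.cos t) • d (a * Real.sin t)) t := by
    intro t
    have h1 := curve_deriv τ K2 G d hq (a * Real.sin t) ((hsin t).trans_lt haτ')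
    have h2 : HasDerivAt (fun t => a * Real.sin t) (a * Real.cos t) t :=
      (Real.hasDerivAt_sin t).const_mul a
    have h3 := h1.scomp t h2
    exact h3.const_add (p 0)
  have hdc : Continuous fun t => (a * Real.cos t) • d (a * Real.sin t) := by
    have h1 : Continuous fun t => d (a * Real.sin t) := by
      have := curve_d_cont τ K2 d hd
      exact this.comp_continuous (by fun_prop) (fun t => hsinτ t)
    exact (continuous_const.mul Real.continuous_cos).smul h1
  set σ : ℝ → V2 := fun t => p 0 + G (a * Real.sin t) with hσ
  have hderiv : deriv σ = fun t => (a * Real.cos t) • d (a * Real.sin t) :=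
    funext fun t => (hσd t).deriv
  have hcos : ∀ t ∈ Icc (-1:ℝ) 1, Real.cos 1 ≤ Real.cos t := by
    intro t ht
    rw [← Real.cos_abs t]
    exact Real.cos_le_cos_of_nonneg_of_le_pi (abs_nonneg _) (by linarith [Real.pi_gt_three]) (abs_le.mpr ht)
  have hnd : ∀ t ∈ Icc (-1:ℝ) 1, 2 * (ϱ * a * Real.cos 1) / 2 ≤ ‖deriv σ t‖ := by
    intro t ht
    rw [hderiv]
    simp only []
    have h1 := hcos t ht
    have h0 := Real.cos_one_pos
    have h00 : 0 < Real.cos t := h0.trans_le h1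
    rw [norm_smul, Real.norm_eq_abs, abs_of_pos (by positivity)]
    have h2 := hdϱ _ (hsinτ t)
    calc 2 * (ϱ * a * Real.cos 1) / 2 = a * Real.cos 1 * ϱ := by ring
      _ ≤ a * Real.cos t * ‖d (a * Real.sin t)‖ := by gcongr
  have hcp : 0 < ϱ * a * Real.cos 1 := by have := Real.cos_one_pos; positivity
  have hdz : ∀ t ∈ Icc (-1:ℝ) 1, deriv σ t ≠ 0 := by
    intro t ht h0
    have := hnd t ht
    rw [h0, norm_zero] at this
    linarith
  have hσ0 : σ 0 = p 0 := by simp [hσ, hz0]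
  refine ⟨σ, by rw [hσ0, hp], ?_, ?_, ?_⟩
  · -- graph
    have hm : 0 < ‖d 0‖ := hϱ.trans_le (hdϱ 0 (by simpa using hτ.le))
    set m := ‖d 0‖ with hmdef
    set e : V2 := m⁻¹ • d 0 with he
    have hde : d 0 = m • e := by rw [he, smul_smul, mul_inv_cancel₀ hm.ne', one_smul]
    have hen : ‖e‖ = 1 := by rw [he, norm_smul, norm_inv, Real.norm_of_nonneg hm.le]; exact inv_mul_cancel₀ hm.ne'
    have hren : ‖rot e‖ = 1 := by rw [rot_norm, hen]
    have hXY : ∀ t ∈ Icc (-1:ℝ) 1, ∀ s ∈ Icc (-1:ℝ) 1,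
        |inner ℝ (rot e) (G (a * Real.sin t)) - inner ℝ (rot e) (G (a * Real.sin s))| ≤
        |inner ℝ e (G (a * Real.sin t)) - inner ℝ e (G (a * Real.sin s))| := by
      intro t _ s _
      have h1 := curve_diff τ a K2 haτ'.le hK2.le ha0.le G d hq hd _ _ (hsin t) (hsin s)
      rw [← inner_sub_right, ← inner_sub_right]
      set v := G (a * Real.sin t) - G (a * Real.sin s)
      set q := a * Real.sin t - a * Real.sin s
      have h2 : ‖v - q • d 0‖ ≤ m / 2 * |q| := by
        refine h1.trans ?_
        have : 3 * K2 * a ≤ m / 2 := by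
          have := hdϱ 0 (by simpa using hτ.le)
          linarith
        gcongr
      have h3 : inner ℝ (rot e) (v - q • d 0) = inner ℝ (rot e) v := by
        rw [inner_sub_right, hde, inner_smul_right, inner_smul_right, real_inner_comm e (rot e), rot_inner]; simp
      have h4 : inner ℝ e (v - q • d 0) = inner ℝ e v - q * m := by
        rw [inner_sub_right, hde, inner_smul_right, inner_smul_right, real_inner_self_eq_norm_sq, hen]; ring
      have h5 := abs_inner_unit (rot e) (v - q • d 0) hren
      have h6 := abs_inner_unit e (v - q • d 0) hen
      rw [h3] at h5
      rw [h4] at h6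
      have h7 : |q * m| ≤ |inner ℝ e v| + |inner ℝ e v - q * m| := by
        have := abs_sub_abs_le_abs_sub (q * m) (inner ℝ e v)
        rw [abs_sub_comm (q * m)] at this
        linarith
      rw [abs_mul, abs_of_pos hm] at h7
      linarith
    obtain ⟨φ, hφ1, hφ2⟩ := graph_fun _ _ _ hXY
    refine ⟨e, rot e, φ, _, hen, hren, rot_inner e, ⟨a * m, by positivity, ?_⟩, hφ1, ?_⟩
    · rw [hderiv]; simp [hde, smul_smul]
    · rw [image_image]
      apply image_congr
      intro t ht
      beta_reduce
      rw [hφ2 t ht, hσ0, add_assoc, ← unit_decomp e _ hen]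
  · -- length
    have hi : IntervalIntegrable (fun t => ‖deriv σ t‖) volume (-1) 1 := by
      rw [hderiv]; exact hdc.norm.intervalIntegrable _ _
    have h1 := intervalIntegral.integral_mono_on (a := (-1:ℝ)) (b := 1) (by norm_num)
      (intervalIntegrable_const (c := 2 * (ϱ * a * Real.cos 1) / 2) (μ := volume)) hi hnd
    rw [intervalIntegral.integral_const, smul_eq_mul] at h1
    unfold clen
    linarith
  · refine ⟨?_, hdz, ?_, max 1 (B * a), le_max_left _ _, 2 * ε, by positivity, ?_⟩
    · rw [contDiff_one_iff_deriv]
      exact ⟨fun t => (hσd t).differentiableAt, by rw [hderiv]; exact hdc⟩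
    · intro t ht s hs hts
      simp only [] at hts
      obtain ⟨k, hk⟩ := proj_eq_imp hts
      have hGn : ∀ t, ‖G (a * Real.sin t)‖ ≤ B * a := by
        intro t
        have := (Hz _ (hsinτ t)).2.1 0
        simp at this
        refine this.trans ?_
        have h2 := hsin t
        rw [abs_mul] at h2
        nlinarith
      have hkv : iv k = G (a * Real.sin s) - G (a * Real.sin t) := by
        simp only [hσ] at hk
        have : iv k = (p 0 + G (a * Real.sin s)) - (p 0 + G (a * Real.sin t)) := by rw [hk]; abel
        rw [this]; abel
      have hk0 : k = 0 := by
        apply iv_zero_of_small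
        rw [hkv]
        refine (norm_sub_le _ _).trans_lt ?_
        linarith [hGn t, hGn s]
      rw [hk0, iv_zero] at hkv
      have hGe : G (a * Real.sin s) = G (a * Real.sin t) := (sub_eq_zero.mp hkv.symm)
      have h1 := (Hz _ (hsinτ t)).2.2.1
      have h2 := (Hz _ (hsinτ s)).2.2.1
      simp only [hG] at hGe
      rw [hGe, h1] at h2
      have h3 : Real.sin t = Real.sin s := by
        have := mul_left_cancel₀ hϱ.ne' h2
        exact mul_left_cancel₀ ha0.ne' this
      have hpi : (1:ℝ) ≤ Real.pi / 2 := by linarith [Real.pi_gt_three]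
      exact Real.injOn_sin ⟨by linarith [ht.1], by linarith [ht.2]⟩ ⟨by linarith [hs.1], by linarith [hs.2]⟩ h3
    · intro t ht
      obtain ⟨hz1, hz2, -⟩ := Hz _ (hsinτ t)
      refine ⟨fun n => proj (p n + z (a * Real.sin t) n), ⟨rfl, ?_⟩, ?_⟩
      · intro n
        have h1 : proj (g.F (p (n + 1))) = proj (p n) := by
          rw [hp, ← hω, ← hp (n + 1), ← g.toFun_proj]
        obtain ⟨k, hk⟩ := proj_eq_imp h1
        simp only []
        rw [g.toFun_proj, hz1 n, hk]
        have : g.F (p (n + 1)) + iv k + (g.F (p (n + 1) + z (a * Real.sin t) (n + 1)) - g.F (p (n + 1)))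
          = g.F (p (n + 1) + z (a * Real.sin t) (n + 1)) + iv k := by abel
        rw [this, proj_add_iv]
      · intro n
        rw [← hp n]
        refine (dist_proj_le _ _).trans ?_
        rw [sub_add_cancel_left, norm_neg]
        refine (hz2 n).trans ?_
        have e1 : -(n:ℝ) * (2 * ε) = -(2 * ε * n) := by ring
        rw [e1]
        have := hsin t
        gcongr
        exact (mul_le_mul_of_nonneg_left this hB.le).trans (le_max_right _ _)
end


lemma udata_of_good (M ε R : ℝ) (g : TorusMap 2) (hg : Nice M g) (hdet : ∀ x, 1 ≤ |g.detD x|)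
    (ω : ℕ → T2) (hω : ∀ n, g.toFun (ω (n + 1)) = ω n) (p : ℕ → V2) (hp : ∀ n, proj (p n) = ω n)
    (hgood : ∀ m k : ℕ, 6 * ε * k - ε * m - R ≤ Sg g ω (m + k) - Sg g ω m) :
    UData M ε R g p (fun n => ‖g.Dninv n (ω n) (ev2 0)‖⁻¹ • g.Dninv n (ω n) (ev2 0)) (Sg g ω) := by
  have hne : ∀ n, 0 < ‖g.Dninv n (ω n) (ev2 0)‖ := fun n =>
    norm_pos_iff.mpr (hg.Dninv_ne n _ _ (ev2_ne 0))
  refine ⟨hg, hdet, ?_, ?_, hgood⟩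
  · intro n
    rw [norm_smul, norm_inv, norm_norm]
    exact inv_mul_cancel₀ (hne n).ne'
  · intro n
    beta_reduce
    have h1 : g.D (ω (n + 1)) (g.Dninv (n + 1) (ω (n + 1)) (ev2 0)) = g.Dninv n (ω n) (ev2 0) := by
      rw [Dninv_succ, D_binv, hω]
    rw [g.fderiv_eq_D, hp, map_smul, h1, smul_smul]
    congr 1
    have h2 : -(Sg g ω (n + 1) - Sg g ω n) = Sg g ω n - Sg g ω (n + 1) := by ring
    rw [h2, Real.exp_sub, Sg, Sg, Real.exp_log (hne n), Real.exp_log (hne (n + 1))]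
    have := (hne n).ne'
    have := (hne (n + 1)).ne'
    field_simp

/-- Let `f` be a `C²` local diffeomorphism of `𝕋²` of degree `d ≥ 2` with
`C(f) > 0` and `inf_x |det Df_x| > 1`. For every `δ > 0` there are `ℓ₀ > 0` and `η > 0`
such that for every `C²` local diffeomorphism `g` with `d_{C²}(f,g) < η` and every
`x ∈ 𝕋²`, the set of backward orbits of `x` admitting a local unstable manifold which is a
`1`-Lipschitz graph centered at `x` of length `> ℓ₀` has `p_x^g`-measure `> 1 - δ`. -/
theorem large_unstable_manifolds (f : TorusMap 2) (hdeg : 2 ≤ f.deg) (hC : 0 < f.C)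
    (hdet : 1 < ⨅ x : T2, |f.detD x|) :
    ∀ δ : ℝ, 0 < δ → ∃ ℓ₀ : ℝ, 0 < ℓ₀ ∧ ∃ η : ℝ, 0 < η ∧
      ∀ g : TorusMap 2, distC 2 f g < η →
        ∀ x : T2, ∀ p : Measure (Bw g x), IsBernoulliBw g x p →
          ENNReal.ofReal (1 - δ) <
            p {ω : Bw g x | ∃ σ : ℝ → V2, ∃ s₀ ∈ Set.Icc (-1 : ℝ) 1,
                proj (σ s₀) = x ∧ IsLipGraph 1 σ s₀ ∧ ℓ₀ < clen σ ∧ IsUnstMan g ω.1 σ} := by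
  intro δ hδ
  obtain ⟨M, hfN, η₀, hη₀, hsetup⟩ := f.setup hdet
  obtain ⟨s, κ, K, η₁, hs, hκ, hK, hη₁, hmom⟩ := moment M f hfN (by omega) hC
  obtain ⟨R, hR, hgm⟩ := good_measure s κ K δ hs hκ hK hδ
  obtain ⟨ℓ₀, hℓ, hbig⟩ := big_curve M (κ / (2 * s) / 6) R hfN.one_le (by positivity) hR
  refine ⟨ℓ₀, hℓ, min η₀ η₁, lt_min hη₀ hη₁, ?_⟩
  intro g hfg x p hpB
  obtain ⟨hgN, hgdet, hgdeg⟩ := hsetup g (hfg.trans_le (min_le_left _ _))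
  have h1 : distC 2 f g < η₁ := hfg.trans_le (min_le_right _ _)
  have hW := hmom g hgN (fun y => f.toFun_dist_le g η₁ h1 y) (fun y => by
    obtain ⟨q, rfl⟩ := proj_surj y
    rw [← f.fderiv_eq_D, ← g.fderiv_eq_D]
    exact f.fderiv_diff_le g η₁ h1 q) hgdeg
  refine (hgm M g hgN (by omega) hW x p hpB).trans_le (measure_mono ?_)
  intro ω hω
  have hback := ω.2
  choose q hq using fun n => proj_surj (ω.1 n)
  have hU := udata_of_good M (κ / (2 * s) / 6) R g hgN hgdet ω.1 hback.2 q hq (by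
    intro m k
    have := hω m k
    have e : 6 * (κ / (2 * s) / 6) = κ / (2 * s) := by ring
    rw [e]; exact this)
  obtain ⟨σ, h0, hL, hl, hm⟩ := hbig g q _ _ ω.1 hU hq hback.2
  exact ⟨σ, 0, by norm_num, h0.trans hback.1, hL, hl, hm⟩

end
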